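/- arXiv:1104.2450 — 2 statements merged into one kernel-verified Lean document; each statement's English description precedes it below -/
import Mathlib

section
/- Let Γ be a finitely generated group, let 𝒫 be a set of primes containing all but finitely many primes, and for each p ∈ 𝒫 let N_p be a finite-index normal subgroup of Γ; write Γ_p := Γ/N_p and Γ_{p,q} := Γ/(N_p ∩ N_q). Assume there is a constant d ∈ ℕ⁺ such that: (1) [property-(τ) with respect to the family (N_p ∩ N_q), stated as a uniform spectral gap] for every finite symmetric generating set Σ of Γ there exists ε > 0 such that for all p, q ∈ 𝒫 and every function f : Γ_{p,q} → ℝ with ∑_{x ∈ Γ_{p,q}} f(x) = 0, one has ∑_{x ∈ Γ_{p,q}} ( |Σ|⁻¹ ∑_{s ∈ Σ} f(π(s)⁻¹·x) )² ≤ (1−ε)·∑_{x ∈ Γ_{p,q}} f(x)², where π : Γ → Γ_{p,q} is the quotient map; (2) |Γ_p| ≤ p^d for every p ∈ 𝒫; (3) for all distinct p, q ∈ 𝒫 the natural map Γ_{p,q} → Γ_p × Γ_q is an isomorphism. Then every subset Z ⊆ Γ for which there exists c > 0 with |Z·N_p/N_p| ≤ (1−c)·|Γ_p| for every p ∈ 𝒫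 is exponentially small in Γ. -/
/-- The probability that the `k`-th step of the random walk driven by the uniform measure on
the finite set `S` lies in the set `Z`. -/
noncomputable def walkProb {G : Type*} [Group G] (S : Finset G) (k : ℕ) (Z : Set G) : ℝ :=
  (Nat.card {w : Fin k → S // (List.ofFn fun i => ((w i : G))).prod ∈ Z} : ℝ) /
    (S.card : ℝ) ^ k

/-- `Z` is exponentially small with respect to `S`. -/
def ExpSmallWrt {G : Type*} [Group G] (S : Finset G) (Z : Set G) : Prop :=
  ∃ c α : ℝ, 0 < c ∧ 0 < α ∧ ∀ k : ℕ, walkProb S k Z ≤ c * Real.exp (-α * k)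

/-- `S` is an admissible subset: symmetric, generating, and satisfying an odd relation. -/
def Admissible {G : Type*} [Group G] (S : Finset G) : Prop :=
  (∀ x : G, x ∈ S ↔ x⁻¹ ∈ S) ∧ Subgroup.closure (S : Set G) = ⊤ ∧
    ∃ k : ℕ, Odd k ∧ ∃ w : Fin k → S, (List.ofFn fun i => ((w i : G))).prod = 1

/-- `Z` is exponentially small: exponentially small with respect to every admissible set. -/
def ExpSmall {G : Type*} [Group G] (Z : Set G) : Prop :=
  ∀ S : Finset G, Admissible S → ExpSmallWrt S Z

open Finset in
/-- The number of primes up to `M` is at least of order `√M`. -/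
theorem sqrt_le_four_mul_primeCounting_add_one (M : ℕ) :
    √(M : ℝ) ≤ 4 * ((Nat.primeCounting M : ℝ) + 1) := by
  rcases Nat.eq_zero_or_pos M with rfl | hM
  · simp
  have hM' : (1 : ℝ) ≤ M := by exact_mod_cast hM
  have h := (Chebyshev.psi_ge M).trans (Chebyshev.psi_le_primeCounting_mul_log M)
  set s := √(M : ℝ) with hs
  have hs0 : 0 < s := by rw [hs]; positivity
  have hss : s * s = M := Real.mul_self_sqrt (by positivity)
  have hlog : Real.log M ≤ 2 * s := by
    rw [← hss, Real.log_mul hs0.ne' hs0.ne']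
    linarith [Real.log_le_sub_one_of_pos hs0]
  have hlog' : Real.log (M + 1) ≤ 2 * s := by
    have h1 : Real.log (M + 1) ≤ Real.log ((s + 1) * (s + 1)) :=
      Real.log_le_log (by positivity) (by nlinarith)
    rw [Real.log_mul (by positivity) (by positivity)] at h1
    linarith [Real.log_le_sub_one_of_pos (show 0 < s + 1 by positivity)]
  have hpi : (Nat.primeCounting M : ℝ) * Real.log M ≤ Nat.primeCounting M * (2 * s) := by gcongr
  have hl2 := Real.log_two_gt_d9
  have h4 : s * s * (1 / 2) ≤ s * (2 * (Nat.primeCounting M + 1)) := by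
    have h6 := mul_le_mul_of_nonneg_left hl2.le (mul_nonneg hs0.le hs0.le)
    rw [← hss] at h hlog' hpi
    nlinarith [mul_pos hs0 hs0]
  have h5 : s * (1 / 2) ≤ 2 * (Nat.primeCounting M + 1) := by
    rw [mul_assoc] at h4
    exact le_of_mul_le_mul_left h4 hs0
  linarith

open Finset in
/-- A set of primes missing only finitely many primes has at least order `√M` elements
up to `M`. -/
theorem exists_sqrt_le_mul_card_primesLE_filter (P : Set ℕ)
    (hP : ({p : ℕ | p.Prime} \ P).Finite) :
    ∃ K : ℝ, 0 < K ∧ ∀ M : ℕ, ∃ A : Finset P, (∀ p ∈ A, (p : ℕ) ≤ M) ∧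
      √(M : ℝ) ≤ K * ((#A : ℝ) + 1) := by
  classical
  refine ⟨4 * (#hP.toFinset + 1), by positivity, fun M ↦
    ⟨(Nat.primesLE M).subtype (· ∈ P), fun p hp ↦ ?_, ?_⟩⟩
  · rw [mem_subtype] at hp
    exact Nat.le_of_mem_primesLE hp
  have h1 : Nat.primeCounting M ≤ #((Nat.primesLE M).subtype (· ∈ P)) + #hP.toFinset := by
    rw [← Nat.primesLE_card_eq_primeCounting, card_subtype]
    refine (card_le_card fun p hp ↦ ?_).trans (card_union_le _ _)
    by_cases hpP : p ∈ P
    · exact mem_union_left _ (mem_filter.2 ⟨hp, hpP⟩)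
    · exact mem_union_right _ (hP.mem_toFinset.2 ⟨Nat.prime_of_mem_primesLE hp, hpP⟩)
  have h2 : (Nat.primeCounting M : ℝ) ≤ #((Nat.primesLE M).subtype (· ∈ P)) + #hP.toFinset := by
    exact_mod_cast h1
  have h3 := sqrt_le_four_mul_primeCounting_add_one M
  set a : ℝ := (#((Nat.primesLE M).subtype (· ∈ P)) : ℝ)
  set b : ℝ := (#hP.toFinset : ℝ)
  have ha : 0 ≤ a := by positivity
  have hb : 0 ≤ b := by positivity
  nlinarith [mul_nonneg ha hb]

open Finset in
/-- Second moment bound: functions bounded by `1` with small pairwise correlations are rarely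
all at least `c`. -/
theorem card_mul_sq_le_of_sum_mul_le {Ω ι : Type*} [Fintype Ω] (A : Finset ι) (Y : ι → Ω → ℝ)
    {c δ : ℝ} (hc : 0 ≤ c) (hδ : 0 ≤ δ) (hY : ∀ p ω, |Y p ω| ≤ 1)
    (hcorr : ∀ p ∈ A, ∀ q ∈ A, p ≠ q → ∑ ω, Y p ω * Y q ω ≤ δ * Fintype.card Ω)
    (B : Finset Ω) (hB : ∀ ω ∈ B, ∀ p ∈ A, c ≤ Y p ω) :
    (#B : ℝ) * (c ^ 2 * (#A : ℝ) ^ 2) ≤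
      Fintype.card Ω * ((#A : ℝ) + (#A : ℝ) ^ 2 * δ) := by
  classical
  calc (#B : ℝ) * (c ^ 2 * (#A : ℝ) ^ 2)
      = ∑ _ω ∈ B, (c * #A) ^ 2 := by rw [sum_const, nsmul_eq_mul, mul_pow]
    _ ≤ ∑ ω ∈ B, (∑ p ∈ A, Y p ω) ^ 2 := by
        refine sum_le_sum fun ω hω ↦ ?_
        have h : c * #A ≤ ∑ p ∈ A, Y p ω := by
          simpa [nsmul_eq_mul, mul_comm] using card_nsmul_le_sum A (fun p ↦ Y p ω) c (hB ω hω)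
        gcongr
    _ ≤ ∑ ω, (∑ p ∈ A, Y p ω) ^ 2 :=
        sum_le_sum_of_subset_of_nonneg (subset_univ _) fun _ _ _ ↦ sq_nonneg _
    _ = ∑ p ∈ A, ∑ q ∈ A, ∑ ω, Y p ω * Y q ω := by
        simp_rw [sq, sum_mul_sum]
        rw [sum_comm]
        exact sum_congr rfl fun p _ ↦ sum_comm
    _ ≤ ∑ p ∈ A, ∑ q ∈ A, ((if p = q then (Fintype.card Ω : ℝ) else 0) +
          δ * Fintype.card Ω) := by
        refine sum_le_sum fun p hp ↦ sum_le_sum fun q hq ↦ ?_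
        split_ifs with hpq
        · subst hpq
          have h : ∑ ω, Y p ω * Y p ω ≤ ∑ _ω : Ω, (1 : ℝ) := by
            refine sum_le_sum fun ω _ ↦ ?_
            rw [← abs_mul_abs_self]
            exact mul_le_one₀ (hY p ω) (abs_nonneg _) (hY p ω)
          simp only [sum_const, card_univ, nsmul_eq_mul, mul_one] at h
          have : 0 ≤ δ * Fintype.card Ω := by positivity
          linarith
        · rw [zero_add]
          exact hcorr p hp q hq hpq
    _ = Fintype.card Ω * ((#A : ℝ) + (#A : ℝ) ^ 2 * δ) := by
        have h : ∑ p ∈ A, (if p ∈ A then (Fintype.card Ω : ℝ) else 0) = #A * Fintype.card Ω := by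
          rw [sum_congr rfl fun p hp ↦ if_pos hp, sum_const, nsmul_eq_mul]
        simp only [sum_add_distrib, sum_ite_eq, sum_const, nsmul_eq_mul, h]
        ring

section Walk

open Finset

variable {Γ G : Type*} [Group Γ] [Group G] [Fintype G]

/-- A spectral gap for one step of a symmetric random walk iterates to `k` steps. -/
theorem sum_sq_walk_le (φ : Γ →* G) (S : Finset Γ) (hS : ∀ x : Γ, x ∈ S ↔ x⁻¹ ∈ S) {ρ : ℝ}
    (hρ : 0 ≤ ρ)
    (hgap : ∀ f : G → ℝ, ∑ x, f x = 0 →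
      ∑ x, ((#S : ℝ)⁻¹ * ∑ s ∈ S, f ((φ s)⁻¹ * x)) ^ 2 ≤ ρ * ∑ x, f x ^ 2)
    (k : ℕ) (f : G → ℝ) (hf : ∑ x, f x = 0) :
    ∑ x, (((#S : ℝ) ^ k)⁻¹ *
      ∑ w : Fin k → S, f (φ (List.ofFn fun i ↦ (w i : Γ)).prod * x)) ^ 2 ≤
        ρ ^ k * ∑ x, f x ^ 2 := by
  induction k generalizing f with
  | zero => simp
  | succ k ih =>
    have hinv (x : G) : ∑ s ∈ S, f ((φ s)⁻¹ * x) = ∑ s : S, f (φ s * x) := by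
      rw [sum_coe_sort S fun s ↦ f (φ s * x)]
      exact sum_nbij' (·⁻¹) (·⁻¹) (fun s hs ↦ (hS s).1 hs) (fun s hs ↦ (hS s).1 hs)
        (by simp) (by simp) (by simp)
    have h0 : ∑ x, (#S : ℝ)⁻¹ * ∑ s : S, f (φ s * x) = 0 := by
      rw [← mul_sum, sum_comm, sum_eq_zero, mul_zero]
      intro s _
      rw [← hf]
      exact Fintype.sum_equiv (Equiv.mulLeft (φ s)) _ _ fun _ ↦ rfl
    have h1 := ih _ h0
    have h2 := hgap f hf
    simp_rw [hinv] at h2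
    refine le_trans (le_of_eq ?_) (h1.trans ?_)
    · refine sum_congr rfl fun x _ ↦ ?_
      congr 1
      rw [← mul_sum, ← mul_assoc, pow_succ, mul_inv]
      congr 1
      rw [← (Fin.consEquiv fun _ ↦ S).sum_comp, Fintype.sum_prod_type, sum_comm]
      simp [Fin.consEquiv, List.ofFn_succ, mul_assoc]
    · rw [pow_succ, mul_assoc]
      gcongr

/-- A symmetric random walk with spectral gap equidistributes exponentially fast on bounded
functions of mean zero. -/
theorem sum_walk_le (φ : Γ →* G) (S : Finset Γ) (hS : ∀ x : Γ, x ∈ S ↔ x⁻¹ ∈ S)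
    (hS0 : S.Nonempty) {ρ : ℝ} (hρ : 0 ≤ ρ)
    (hgap : ∀ f : G → ℝ, ∑ x, f x = 0 →
      ∑ x, ((#S : ℝ)⁻¹ * ∑ s ∈ S, f ((φ s)⁻¹ * x)) ^ 2 ≤ ρ * ∑ x, f x ^ 2)
    (k : ℕ) (f : G → ℝ) (hf : ∑ x, f x = 0) (hf1 : ∀ x, |f x| ≤ 1) :
    ∑ w : Fin k → S, f (φ (List.ofFn fun i ↦ (w i : Γ)).prod) ≤
        √(ρ ^ k * Fintype.card G) * (#S : ℝ) ^ k := by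
  have h1 := sum_sq_walk_le φ S hS hρ hgap k f hf
  have h2 := (single_le_sum (fun _ _ ↦ sq_nonneg _) (mem_univ (1 : G))).trans h1
  have h3 : ∑ x, f x ^ 2 ≤ Fintype.card G := by
    refine (sum_le_sum fun x _ ↦ (sq_le_one_iff_abs_le_one _).2 (hf1 x)).trans ?_
    simp
  have h4 := Real.le_sqrt_of_sq_le (h2.trans (mul_le_mul_of_nonneg_left h3 (pow_nonneg hρ k)))
  have hc : 0 < (#S : ℝ) ^ k := pow_pos (by exact_mod_cast hS0.card_pos) k
  simp only [mul_one] at h4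
  rwa [inv_mul_le_iff₀ hc, mul_comm] at h4

end Walk

/-- The indicator of a subset of a finite type, recentred to have mean zero. -/
noncomputable def centredIndicator {α : Type*} (T : Set α) (x : α) : ℝ :=
  T.indicator 1 x - (Nat.card T : ℝ) / Nat.card α

section centredIndicator

variable {α : Type*} (T : Set α)

theorem natCard_div_natCard_mem_Icc [Finite α] : (Nat.card T : ℝ) / Nat.card α ∈ Set.Icc 0 1 :=
  ⟨by positivity, div_le_one_of_le₀ (by exact_mod_cast Finite.card_subtype_le _) (by positivity)⟩

theorem abs_centredIndicator_le_one [Finite α] (x : α) : |centredIndicator T x| ≤ 1 := by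
  obtain ⟨h0, h1⟩ := natCard_div_natCard_mem_Icc T
  classical
  simp only [centredIndicator, Set.indicator_apply, Pi.one_apply, abs_le]
  split_ifs <;> constructor <;> linarith

theorem sum_centredIndicator [Fintype α] [Nonempty α] : ∑ x, centredIndicator T x = 0 := by
  classical
  have h : (Fintype.card α : ℝ) ≠ 0 := by exact_mod_cast Fintype.card_ne_zero
  simp only [centredIndicator, Finset.sum_sub_distrib, Set.indicator_apply, Pi.one_apply,
    Finset.sum_boole, Finset.sum_const, Finset.card_univ, nsmul_eq_mul, Nat.card_eq_fintype_card,
    Fintype.card_subtype]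
  rw [mul_div_cancel₀ _ h, sub_self]

theorem le_centredIndicator [Finite α] [Nonempty α] {c : ℝ}
    (hT : (Nat.card T : ℝ) ≤ (1 - c) * Nat.card α) {x : α} (hx : x ∈ T) :
    c ≤ centredIndicator T x := by
  have h : (0 : ℝ) < Nat.card α := by exact_mod_cast Nat.card_pos
  have := (div_le_iff₀ h).2 hT
  rw [centredIndicator, Set.indicator_of_mem hx, Pi.one_apply]
  linarith

end centredIndicator

/-- Pairs of coordinates of the random walk in independent finite quotients are almost
uncorrelated. -/
theorem sum_walk_mul_le {Γ : Type*} [Group Γ] (H K : Subgroup Γ) [H.Normal] [K.Normal]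
    [H.FiniteIndex] [K.FiniteIndex] (S : Finset Γ) (hS : ∀ x : Γ, x ∈ S ↔ x⁻¹ ∈ S)
    (hS0 : S.Nonempty) {ρ : ℝ} (hρ : 0 ≤ ρ)
    (hgap : ∀ f : Γ ⧸ (H ⊓ K) → ℝ, (∑ᶠ x : Γ ⧸ (H ⊓ K), f x) = 0 →
      ∑ᶠ x : Γ ⧸ (H ⊓ K),
        ((S.card : ℝ)⁻¹ * ∑ s ∈ S, f ((QuotientGroup.mk' (H ⊓ K) s)⁻¹ * x)) ^ 2 ≤
          ρ * ∑ᶠ x : Γ ⧸ (H ⊓ K), (f x) ^ 2)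
    (e : Γ ⧸ (H ⊓ K) ≃* (Γ ⧸ H) × (Γ ⧸ K))
    (he : ∀ x : Γ, e (QuotientGroup.mk x) = (QuotientGroup.mk x, QuotientGroup.mk x))
    {D : ℝ} (hD : 0 ≤ D) (hH : (Nat.card (Γ ⧸ H) : ℝ) ≤ D) (hK : (Nat.card (Γ ⧸ K) : ℝ) ≤ D)
    (T : Set (Γ ⧸ H)) (U : Set (Γ ⧸ K)) (k : ℕ) :
    ∑ w : Fin k → S,
      centredIndicator T (QuotientGroup.mk (List.ofFn fun i ↦ (w i : Γ)).prod) *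
        centredIndicator U (QuotientGroup.mk (List.ofFn fun i ↦ (w i : Γ)).prod) ≤
      √ρ ^ k * D * (S.card : ℝ) ^ k := by
  have : Finite (Γ ⧸ (H ⊓ K)) := .of_equiv _ e.symm.toEquiv
  have := Fintype.ofFinite (Γ ⧸ (H ⊓ K))
  have := Fintype.ofFinite (Γ ⧸ H)
  have := Fintype.ofFinite (Γ ⧸ K)
  simp only [finsum_eq_sum_of_fintype] at hgap
  have h := sum_walk_le (QuotientGroup.mk' (H ⊓ K)) S hS hS0 hρ hgap k
    (fun x ↦ centredIndicator T (e x).1 * centredIndicator U (e x).2) ?_ ?_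
  · simp only [QuotientGroup.mk'_apply, he] at h
    refine h.trans ?_
    gcongr
    have hρk : √ρ ^ k * √ρ ^ k = ρ ^ k := by rw [← mul_pow, Real.mul_self_sqrt hρ]
    have hcard : (Fintype.card (Γ ⧸ (H ⊓ K)) : ℝ) ≤ D * D := by
      rw [← Nat.card_eq_fintype_card, Nat.card_congr e.toEquiv, Nat.card_prod, Nat.cast_mul]
      gcongr
    refine Real.sqrt_le_iff.2 ⟨by positivity, ?_⟩
    calc ρ ^ k * (Fintype.card (Γ ⧸ (H ⊓ K)) : ℝ) ≤ ρ ^ k * (D * D) := by gcongr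
      _ = (√ρ ^ k * D) ^ 2 := by rw [← hρk]; ring
  · rw [← e.symm.toEquiv.sum_comp, Fintype.sum_prod_type]
    simp [← Finset.mul_sum, sum_centredIndicator]
  · intro x
    rw [abs_mul]
    exact mul_le_one₀ (abs_centredIndicator_le_one _ _) (abs_nonneg _)
      (abs_centredIndicator_le_one _ _)

theorem walkProb_mul_card_pow {G : Type*} [Group G] {S : Finset G} (hS0 : S.Nonempty) (k : ℕ)
    (Z : Set G) :
    walkProb S k Z * (S.card : ℝ) ^ k =
      Nat.card {w : Fin k → S // (List.ofFn fun i ↦ (w i : G)).prod ∈ Z} :=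
  div_mul_cancel₀ _ (pow_pos (by exact_mod_cast hS0.card_pos) k).ne'

theorem walkProb_le_one {G : Type*} [Group G] (S : Finset G) (k : ℕ) (Z : Set G) :
    walkProb S k Z ≤ 1 := by
  refine div_le_one_of_le₀ ?_ (by positivity)
  have h := Finite.card_subtype_le fun w : Fin k → S ↦ (List.ofFn fun i ↦ (w i : G)).prod ∈ Z
  have h' : Nat.card (Fin k → S) = S.card ^ k := by simp
  rw [h'] at h
  exact_mod_cast h

theorem le_of_mul_sq_le {x c n δ : ℝ} (hx1 : x ≤ 1) (hc : 0 < c) (hδ : 0 ≤ δ)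
    (hn : n = 0 ∨ 1 ≤ n) (h : x * (c ^ 2 * n ^ 2) ≤ n + n ^ 2 * δ) :
    x ≤ 2 * (1 + 1 / c ^ 2) * (n + 1)⁻¹ + δ / c ^ 2 := by
  have hc2 : 0 < 1 / c ^ 2 := by positivity
  have hd : 0 ≤ δ / c ^ 2 := by positivity
  rcases hn with rfl | hn
  · rw [zero_add, inv_one, mul_one]
    linarith
  have hn0 : 0 < n := by linarith
  have h1 : x ≤ 1 / c ^ 2 * n⁻¹ + δ / c ^ 2 := by
    have : x ≤ (n + n ^ 2 * δ) / (c ^ 2 * n ^ 2) := (le_div_iff₀ (by positivity)).2 h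
    refine this.trans (le_of_eq ?_)
    field_simp
  have h2 : n⁻¹ ≤ 2 * (n + 1)⁻¹ := by
    rw [← div_eq_mul_inv, inv_eq_one_div, div_le_div_iff₀ hn0 (by linarith)]
    linarith
  have h3 : 0 ≤ (n + 1)⁻¹ := by positivity
  have h4 := mul_le_mul_of_nonneg_left h2 hc2.le
  linarith

/-- Theorem (sieve method, Theorem 2 of [LM]): under property-(τ) (stated as a uniform
spectral gap), polynomial bounds on the quotients, and independence of the quotients,
any set whose projections are uniformly not-everything is exponentially small. -/
theorem sieve_theorem {Γ : Type*} [Group Γ] (hΓ : Group.FG Γ)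
    (P : Set ℕ) (hP : ∀ p ∈ P, Nat.Prime p) (hP' : ({p : ℕ | p.Prime} \ P).Finite)
    (N : P → Subgroup Γ) [hnorm : ∀ p : P, (N p).Normal]
    (hfin : ∀ p : P, (N p).FiniteIndex)
    (d : ℕ) (hd : 0 < d)
    -- (1) property-(τ) with respect to the family (N p ⊓ N q), as a uniform spectral gap
    (h1 : ∀ S : Finset Γ, (∀ x : Γ, x ∈ S ↔ x⁻¹ ∈ S) →
      Subgroup.closure (S : Set Γ) = ⊤ →
      ∃ ε : ℝ, 0 < ε ∧ ∀ p q : P, ∀ f : Γ ⧸ (N p ⊓ N q) → ℝ,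
        (∑ᶠ x : Γ ⧸ (N p ⊓ N q), f x) = 0 →
        ∑ᶠ x : Γ ⧸ (N p ⊓ N q),
            ((S.card : ℝ)⁻¹ * ∑ s ∈ S, f ((QuotientGroup.mk' (N p ⊓ N q) s)⁻¹ * x)) ^ 2 ≤
          (1 - ε) * ∑ᶠ x : Γ ⧸ (N p ⊓ N q), (f x) ^ 2)
    -- (2) |Γ_p| ≤ p ^ d
    (h2 : ∀ p : P, Nat.card (Γ ⧸ N p) ≤ (p : ℕ) ^ d)
    -- (3) the natural map Γ_{p,q} → Γ_p × Γ_q is an isomorphism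
    (h3 : ∀ p q : P, (p : ℕ) ≠ (q : ℕ) →
      ∃ e : Γ ⧸ (N p ⊓ N q) ≃* (Γ ⧸ N p) × (Γ ⧸ N q),
        ∀ x : Γ, e (QuotientGroup.mk x) =
          (QuotientGroup.mk x, QuotientGroup.mk x))
    (Z : Set Γ) (c : ℝ) (hc : 0 < c)
    -- (4) |Z_p| ≤ (1 - c)|Γ_p|
    (h4 : ∀ p : P, (Nat.card ((QuotientGroup.mk' (N p)) '' Z) : ℝ) ≤
      (1 - c) * (Nat.card (Γ ⧸ N p) : ℝ)) :
    ExpSmall Z := by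
  rintro S ⟨hS, hgen, m, hm, w₀, -⟩
  have hS0 : S.Nonempty := ⟨_, (w₀ ⟨0, hm.pos⟩).2⟩
  obtain ⟨ε, hε, hgap⟩ := h1 S hS hgen
  obtain ⟨K, hK, hA⟩ := exists_sqrt_le_mul_card_primesLE_filter P hP'
  set ρ : ℝ := max (1 - ε) (1 / 2) with hρ
  have hρ0 : 0 < ρ := lt_max_of_lt_right (by norm_num)
  have hρ1 : ρ < 1 := max_lt (by linarith) (by norm_num)
  have hr0 : 0 < √ρ := Real.sqrt_pos.2 hρ0
  have hr1 : √ρ < 1 := (Real.sqrt_lt' one_pos).2 (by simpa using hρ1)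
  set β : ℝ := -Real.log √ρ / (d + 1) with hβ
  have hβ0 : 0 < β := div_pos (by linarith [Real.log_neg hr0 hr1]) (by positivity)
  have hrβ : √ρ = Real.exp (-((d + 1) * β)) := by
    rw [hβ, mul_div_cancel₀ _ (by positivity), neg_neg, Real.exp_log hr0]
  refine ⟨2 * (1 + 1 / c ^ 2) * (2 * K) + 1 / c ^ 2, β / 2, by positivity, by positivity,
    fun k ↦ ?_⟩
  set M : ℕ := ⌊Real.exp (β * k)⌋₊ with hM
  have hMle : (M : ℝ) ≤ Real.exp (β * k) := Nat.floor_le (Real.exp_nonneg _)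
  have hMge : Real.exp (β * k) / 4 ≤ M := by
    have h : 1 ≤ Real.exp (β * k) := Real.one_le_exp (by positivity)
    have h' : 1 ≤ (M : ℝ) := by exact_mod_cast (Nat.one_le_floor_iff _).2 h
    have := Nat.lt_floor_add_one (Real.exp (β * k))
    rw [← hM] at this
    linarith
  obtain ⟨A, hAM, hAcard⟩ := hA M
  have hδ : √ρ ^ k * (M : ℝ) ^ d ≤ Real.exp (-(β / 2) * k) := by
    calc √ρ ^ k * (M : ℝ) ^ d ≤ √ρ ^ k * Real.exp (β * k) ^ d := by gcongr
      _ = Real.exp (-(β * k)) := by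
        rw [hrβ, ← Real.exp_nat_mul, ← Real.exp_nat_mul, ← Real.exp_add]
        congr 1
        ring
      _ ≤ _ := Real.exp_le_exp.2 (by
        have : 0 ≤ β * k := by positivity
        linarith)
  have hn : ((A.card : ℝ) + 1)⁻¹ ≤ 2 * K * Real.exp (-(β / 2) * k) := by
    have h : Real.exp (β / 2 * k) / 2 ≤ √(M : ℝ) := by
      refine Real.le_sqrt_of_sq_le (le_trans (le_of_eq ?_) hMge)
      rw [div_pow, ← Real.exp_nat_mul]
      norm_num
      ring_nf
    rw [neg_mul, Real.exp_neg, ← div_eq_mul_inv, inv_eq_one_div,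
      div_le_div_iff₀ A.card.cast_add_one_pos (Real.exp_pos _)]
    linarith
  have hmain : walkProb S k Z * (c ^ 2 * (A.card : ℝ) ^ 2) ≤
      (A.card : ℝ) + (A.card : ℝ) ^ 2 * (√ρ ^ k * (M : ℝ) ^ d) := by
    classical
    have hcard : (Fintype.card (Fin k → S) : ℝ) = (S.card : ℝ) ^ k := by simp
    have hpos : (0 : ℝ) < (S.card : ℝ) ^ k := pow_pos (by exact_mod_cast hS0.card_pos) k
    have hsm := card_mul_sq_le_of_sum_mul_le A
      (fun p (w : Fin k → S) ↦ centredIndicator (QuotientGroup.mk' (N p) '' Z)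
        (QuotientGroup.mk (List.ofFn fun i ↦ (w i : Γ)).prod))
      hc.le (δ := √ρ ^ k * (M : ℝ) ^ d) (by positivity)
      (fun p w ↦ abs_centredIndicator_le_one _ _) ?_
      (Finset.univ.filter fun w ↦ (List.ofFn fun i ↦ (w i : Γ)).prod ∈ Z) ?_
    · rw [← Fintype.card_subtype, ← Nat.card_eq_fintype_card, ← walkProb_mul_card_pow hS0, hcard,
        mul_comm (walkProb S k Z), mul_assoc] at hsm
      exact le_of_mul_le_mul_left hsm hpos
    · intro p hp q hq hpq
      obtain ⟨e, he⟩ := h3 p q (fun h ↦ hpq (Subtype.ext h))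
      have hbound (p : P) (hp : p ∈ A) : (Nat.card (Γ ⧸ N p) : ℝ) ≤ (M : ℝ) ^ d := by
        exact_mod_cast (h2 p).trans (Nat.pow_le_pow_left (hAM p hp) d)
      rw [hcard]
      refine sum_walk_mul_le (N p) (N q) S hS hS0 hρ0.le (fun f hf ↦ ?_) e he (by positivity)
        (hbound p hp) (hbound q hq) _ _ k
      exact (hgap p q f hf).trans (mul_le_mul_of_nonneg_right (le_max_left _ _)
        (finsum_nonneg fun _ ↦ sq_nonneg _))
    · intro w hw p _
      exact le_centredIndicator _ (h4 p) ⟨_, (Finset.mem_filter.1 hw).2, rfl⟩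
  have hn' : (A.card : ℝ) = 0 ∨ 1 ≤ (A.card : ℝ) := by
    rcases Nat.eq_zero_or_pos A.card with h | h
    · exact .inl (by exact_mod_cast h)
    · exact .inr (by exact_mod_cast h)
  refine (le_of_mul_sq_le (walkProb_le_one S k Z) hc (by positivity) hn' hmain).trans ?_
  have h5 : √ρ ^ k * (M : ℝ) ^ d / c ^ 2 ≤ 1 / c ^ 2 * Real.exp (-(β / 2) * k) := by
    rw [div_mul_eq_mul_div, one_mul]
    gcongr
  have h6 := mul_le_mul_of_nonneg_left hn (show 0 ≤ 2 * (1 + 1 / c ^ 2) by positivity)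
  linarith
end

section
/- Let g ≥ 2. The set of matrices A ∈ Sp(2g, ℤ) whose characteristic polynomial is reducible over ℚ (i.e. is not irreducible in ℚ[x]) is exponentially small in the group Sp(2g, ℤ). -/
theorem isometryRep_mul_apply {G H : Type*} [Group G] [NormedAddCommGroup H]
    [InnerProductSpace ℂ H] (π : G →* (H ≃ₗᵢ[ℂ] H)) (a b : G) (v : H) :
    π (a * b) v = π a (π b v) := by
  rw [map_mul]; rfl

section FiniteFourier

variable {A : Type} [AddCommGroup A] [Fintype A]
variable {H : Type} [NormedAddCommGroup H] [InnerProductSpace ℂ H]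

/-- The component of `v` on which the finite abelian group `A` acts through the character `ψ`. -/
noncomputable def isotypic (σ : Multiplicative A →* (H ≃ₗᵢ[ℂ] H)) (ψ : AddChar A ℂ) (v : H) : H :=
  (Fintype.card A : ℂ)⁻¹ • ∑ x, ψ (-x) • σ (.ofAdd x) v

variable (σ : Multiplicative A →* (H ≃ₗᵢ[ℂ] H))

theorem isotypic_apply (ψ : AddChar A ℂ) (y : A) (v : H) :
    isotypic σ ψ (σ (.ofAdd y) v) = ψ y • isotypic σ ψ v := by
  rw [isotypic, isotypic, smul_comm]
  congr 1
  rw [Finset.smul_sum, ← Equiv.sum_comp (Equiv.subRight y)]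
  refine Finset.sum_congr rfl fun x _ => ?_
  rw [smul_smul, ← AddChar.map_add_eq_mul, ← isometryRep_mul_apply, ← ofAdd_add]
  simp [sub_eq_add_neg]

theorem apply_isotypic (ψ : AddChar A ℂ) (y : A) (v : H) :
    σ (.ofAdd y) (isotypic σ ψ v) = ψ y • isotypic σ ψ v := by
  rw [← isotypic_apply, isotypic, isotypic, map_smul, map_sum]
  simp only [map_smul, ← isometryRep_mul_apply, mul_comm]

theorem isotypic_sub (ψ : AddChar A ℂ) (v w : H) :
    isotypic σ ψ (v - w) = isotypic σ ψ v - isotypic σ ψ w := by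
  simp [isotypic, smul_sub]

theorem sum_isotypic (v : H) : ∑ ψ, isotypic σ ψ v = v := by
  classical
  simp only [isotypic]
  rw [← Finset.smul_sum, Finset.sum_comm]
  simp only [← Finset.sum_smul, AddChar.sum_apply_eq_ite]
  simp [smul_smul]

theorem inner_isotypic {ψ χ : AddChar A ℂ} (h : ψ ≠ χ) (v w : H) :
    inner ℂ (isotypic σ ψ v) (isotypic σ χ w) = 0 := by
  obtain ⟨y, hy⟩ : ∃ y, ψ y ≠ χ y := by
    by_contra! hh
    exact h (DFunLike.ext _ _ hh)
  have h1 := LinearIsometryEquiv.inner_map_map (σ (.ofAdd y)) (isotypic σ ψ v) (isotypic σ χ w)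
  rw [apply_isotypic, apply_isotypic, inner_smul_left, inner_smul_right, ← mul_assoc] at h1
  by_contra h0
  have h2 : (starRingEnd ℂ) (ψ y) * χ y = 1 := by
    rw [← sub_eq_zero] at h1 ⊢
    have : ((starRingEnd ℂ) (ψ y) * χ y - 1) *
        inner ℂ (isotypic σ ψ v) (isotypic σ χ w) = 0 := by linear_combination h1
    exact (mul_eq_zero.1 this).resolve_right h0
  have h3 : ψ y * (starRingEnd ℂ) (ψ y) = 1 := by
    rw [Complex.mul_conj, Complex.normSq_eq_norm_sq, AddChar.norm_apply]; simp
  apply hy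
  linear_combination (-ψ y) * h2 + χ y * h3

theorem sum_norm_isotypic_sq (v : H) : ∑ ψ, ‖isotypic σ ψ v‖ ^ 2 = ‖v‖ ^ 2 := by
  have h : inner ℂ v v = ∑ ψ, inner ℂ (isotypic σ ψ v) (isotypic σ ψ v) := by
    conv_lhs => rw [← sum_isotypic σ v]
    rw [sum_inner]
    refine Finset.sum_congr rfl fun ψ _ => ?_
    rw [inner_sum]
    exact Finset.sum_eq_single_of_mem ψ (Finset.mem_univ _)
      fun χ _ hχ => inner_isotypic σ hχ.symm v v
  simp only [inner_self_eq_norm_sq_to_K] at h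
  exact_mod_cast h.symm

theorem norm_apply_sub_sq (x : A) (v : H) :
    ‖σ (.ofAdd x) v - v‖ ^ 2 = ∑ ψ : AddChar A ℂ, ‖ψ x - 1‖ ^ 2 * ‖isotypic σ ψ v‖ ^ 2 := by
  rw [← sum_norm_isotypic_sq σ]
  refine Finset.sum_congr rfl fun ψ _ => ?_
  rw [isotypic_sub, isotypic_apply, ← mul_pow, ← norm_smul, sub_smul, one_smul]

theorem norm_isotypic_map (T : H ≃ₗᵢ[ℂ] H) (φ : A ≃+ A)
    (hT : ∀ x v, T (σ (.ofAdd x) v) = σ (.ofAdd (φ x)) (T v)) (ψ : AddChar A ℂ) (v : H) :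
    ‖isotypic σ ψ (T v)‖ = ‖isotypic σ (ψ.compAddMonoidHom φ.toAddMonoidHom) v‖ := by
  rw [← T.norm_map (isotypic σ _ v)]
  congr 1
  rw [isotypic, isotypic, map_smul, map_sum, ← Equiv.sum_comp φ.toEquiv]
  congr 1
  refine Finset.sum_congr rfl fun x _ => ?_
  rw [map_smul, hT]
  simp

/-- The spectral weights of an almost invariant vector are almost invariant in `ℓ¹`. -/
theorem sum_abs_isotypic_sub_le (T : H ≃ₗᵢ[ℂ] H) (φ : A ≃+ A)
    (hT : ∀ x v, T (σ (.ofAdd x) v) = σ (.ofAdd (φ x)) (T v)) (v : H) :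
    ∑ ψ : AddChar A ℂ, |‖isotypic σ (ψ.compAddMonoidHom φ.toAddMonoidHom) v‖ ^ 2
      - ‖isotypic σ ψ v‖ ^ 2| ≤ 2 * ‖T v - v‖ * ‖v‖ := by
  set a : AddChar A ℂ → ℝ := fun ψ => ‖isotypic σ ψ (T v)‖
  set b : AddChar A ℂ → ℝ := fun ψ => ‖isotypic σ ψ v‖
  set d : AddChar A ℂ → ℝ := fun ψ => ‖isotypic σ ψ (T v - v)‖
  have hd : √(∑ ψ, d ψ ^ 2) = ‖T v - v‖ := by
    rw [sum_norm_isotypic_sq, Real.sqrt_sq (norm_nonneg _)]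
  have ha : √(∑ ψ, a ψ ^ 2) = ‖v‖ := by
    rw [sum_norm_isotypic_sq, T.norm_map, Real.sqrt_sq (norm_nonneg _)]
  have hb : √(∑ ψ, b ψ ^ 2) = ‖v‖ := by
    rw [sum_norm_isotypic_sq, Real.sqrt_sq (norm_nonneg _)]
  have h1 := Real.sum_mul_le_sqrt_mul_sqrt Finset.univ d a
  have h2 := Real.sum_mul_le_sqrt_mul_sqrt Finset.univ d b
  rw [hd, ha] at h1
  rw [hd, hb] at h2
  calc _ ≤ ∑ ψ, (d ψ * a ψ + d ψ * b ψ) := by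
        refine Finset.sum_le_sum fun ψ _ => ?_
        rw [← norm_isotypic_map σ T φ hT]
        change |a ψ ^ 2 - b ψ ^ 2| ≤ _
        have h3 : |a ψ - b ψ| ≤ d ψ := by
          simp only [a, b, d, isotypic_sub]
          exact abs_norm_sub_norm_le _ _
        have ha0 : 0 ≤ a ψ := norm_nonneg _
        have hb0 : 0 ≤ b ψ := norm_nonneg _
        rw [sq_sub_sq, abs_mul, abs_of_nonneg (add_nonneg ha0 hb0), ← mul_add, mul_comm]
        exact mul_le_mul_of_nonneg_right h3 (add_nonneg ha0 hb0)
    _ ≤ _ := by rw [Finset.sum_add_distrib]; linarith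

end FiniteFourier

section Dominance

theorem quadratic_dominated {a b c : ℝ} {i j k : ℤ} (hij : i ≠ j) (hik : i ≠ k) (hjk : j ≠ k)
    (hi : |c + 2 * i * b + 4 * i ^ 2 * a| ≤ |a|) (hj : |c + 2 * j * b + 4 * j ^ 2 * a| ≤ |a|)
    (hk : |c + 2 * k * b + 4 * k ^ 2 * a| ≤ |a|) : a = 0 ∧ b = 0 := by
  have ha : a = 0 := by
    by_contra ha
    have ha' : 0 < |a| := abs_pos.2 ha
    have h1 : (1 : ℝ) ≤ |((i - j : ℤ) : ℝ)| := by
      exact_mod_cast Int.one_le_abs (sub_ne_zero.2 hij)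
    have h2 : (1 : ℝ) ≤ |((i - k : ℤ) : ℝ)| := by
      exact_mod_cast Int.one_le_abs (sub_ne_zero.2 hik)
    have h3 : (1 : ℝ) ≤ |((j - k : ℤ) : ℝ)| := by
      exact_mod_cast Int.one_le_abs (sub_ne_zero.2 hjk)
    set x := |((i - j : ℤ) : ℝ)| with hx
    set y := |((i - k : ℤ) : ℝ)| with hy
    set z := |((j - k : ℤ) : ℝ)| with hz
    have key : 4 * (x * y * z) * |a| ≤ (z + y + x) * |a| := by
      have e : 4 * (((i - j : ℤ) : ℝ) * ((i - k : ℤ) : ℝ) * ((j - k : ℤ) : ℝ)) * a =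
          (c + 2 * i * b + 4 * i ^ 2 * a) * ((j - k : ℤ) : ℝ)
          - (c + 2 * j * b + 4 * j ^ 2 * a) * ((i - k : ℤ) : ℝ)
          + (c + 2 * k * b + 4 * k ^ 2 * a) * ((i - j : ℤ) : ℝ) := by
        push_cast; ring
      have e' := congrArg abs e
      rw [abs_mul, abs_mul, abs_mul, abs_mul, ← hx, ← hy, ← hz,
        abs_of_pos (by norm_num : (0 : ℝ) < 4)] at e'
      rw [e']
      refine (abs_add_le _ _).trans ?_
      refine (add_le_add (abs_sub _ _) le_rfl).trans ?_
      simp only [abs_mul, ← hx, ← hy, ← hz]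
      nlinarith
    have key' : 4 * (x * y * z) ≤ z + y + x := le_of_mul_le_mul_right key ha'
    have hxy : 1 ≤ x * y := one_le_mul_of_one_le_of_one_le h1 h2
    have hyz : 1 ≤ y * z := one_le_mul_of_one_le_of_one_le h2 h3
    have hxz : 1 ≤ x * z := one_le_mul_of_one_le_of_one_le h1 h3
    have p1 : z ≤ x * y * z := le_mul_of_one_le_left (by linarith) hxy
    have p2 : x ≤ x * (y * z) := le_mul_of_one_le_right (by linarith) hyz
    have p3 : y ≤ y * (x * z) := le_mul_of_one_le_right (by linarith) hxz
    nlinarith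
  refine ⟨ha, ?_⟩
  subst ha
  simp only [abs_zero, mul_zero, add_zero, abs_nonpos_iff] at hi hj
  have h : (2 * ((i : ℝ) - j)) * b = 0 := by linear_combination hi - hj
  have hne : (2 * ((i : ℝ) - j)) ≠ 0 := by
    have : (i : ℝ) ≠ j := by exact_mod_cast hij
    exact mul_ne_zero two_ne_zero (sub_ne_zero.2 this)
  exact (mul_eq_zero.1 h).resolve_left hne

open Classical in
theorem three_le_sum_dominant {a b : ℝ} (c : ℝ) (h : ¬ (a = 0 ∧ b = 0)) :
    (3 : ℝ) ≤ ∑ n ∈ Finset.range 5,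
      if |a| < |c + 2 * (n : ℤ) * b + 4 * (n : ℤ) ^ 2 * a| then 1 else 0 := by
  have hcard : ((Finset.range 5).filter
      fun n : ℕ => ¬ |a| < |c + 2 * (n : ℤ) * b + 4 * (n : ℤ) ^ 2 * a|).card ≤ 2 := by
    by_contra! hlt
    obtain ⟨i, hi, j, hj, k, hk, hij, hik, hjk⟩ := Finset.two_lt_card.1 hlt
    simp only [Finset.mem_filter] at hi hj hk
    exact h (quadratic_dominated (by exact_mod_cast hij) (by exact_mod_cast hik)
      (by exact_mod_cast hjk) hi.2 hj.2 hk.2)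
  have hadd := Finset.card_filter_add_card_filter_not (s := Finset.range 5)
    (fun n : ℕ => |a| < |c + 2 * (n : ℤ) * b + 4 * (n : ℤ) ^ 2 * a|)
  rw [Finset.card_range] at hadd
  rw [Finset.sum_boole]
  exact (Nat.cast_le.2 (by omega)).trans' (by norm_num : (3 : ℝ) ≤ ((3 : ℕ) : ℝ))

open Classical in
/-- Ping-pong for binary quadratic forms `(a, b, c)` under the two unipotent subgroups. -/
theorem one_le_pingPong {a b c : ℝ} (h : ¬ (a = 0 ∧ b = 0 ∧ c = 0)) :
    (1 : ℝ) ≤ ∑ n ∈ Finset.range 5,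
      (((if |a| < |c + 2 * (n : ℤ) * b + 4 * (n : ℤ) ^ 2 * a| then 1 else 0)
          - if |a| < |c| then 1 else 0)
        + ((if |c| < |a + 2 * (n : ℤ) * b + 4 * (n : ℤ) ^ 2 * c| then 1 else 0)
          - if |c| < |a| then 1 else 0)) := by
  by_cases hab : a = 0 ∧ b = 0
  · obtain ⟨rfl, rfl⟩ := hab
    have hc : c ≠ 0 := by tauto
    have h3 := three_le_sum_dominant (a := c) (b := 0) 0 (by tauto)
    simp only [mul_zero, add_zero, zero_add, abs_zero, abs_pos.2 hc] at h3 ⊢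
    simp only [not_lt.2 (abs_nonneg c), if_true, if_false, sub_self, sub_zero, zero_add]
    linarith
  by_cases hcb : c = 0 ∧ b = 0
  · obtain ⟨rfl, rfl⟩ := hcb
    have ha : a ≠ 0 := by tauto
    have h3 := three_le_sum_dominant (a := a) (b := 0) 0 (by tauto)
    simp only [mul_zero, add_zero, zero_add, abs_zero, abs_pos.2 ha] at h3 ⊢
    simp only [not_lt.2 (abs_nonneg a), if_true, if_false, sub_self, sub_zero, add_zero]
    linarith
  have h1 := three_le_sum_dominant c hab
  have h2 := three_le_sum_dominant a hcb
  rw [Finset.sum_add_distrib, Finset.sum_sub_distrib, Finset.sum_sub_distrib]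
  simp only [Finset.sum_const, Finset.card_range, nsmul_eq_mul]
  have h4 : ((if |a| < |c| then 1 else 0) + if |c| < |a| then 1 else 0 : ℝ) ≤ 1 := by
    split_ifs with p q
    · exact absurd p (lt_asymm q)
    all_goals norm_num
  push_cast at *
  linarith

end Dominance

section RelativeT

theorem exp_arg_addChar {A : Type*} [AddCommGroup A] [Finite A] (ψ : AddChar A ℂ) (x : A) :
    ψ x = Complex.exp ((Complex.arg (ψ x) : ℝ) * Complex.I) := by
  have h := Complex.norm_mul_exp_arg_mul_I (ψ x)
  rw [AddChar.norm_apply] at h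
  simpa using h.symm

theorem arg_addChar_add {A : Type*} [AddCommGroup A] [Finite A] (ψ : AddChar A ℂ) (x y z : A)
    (k l : ℕ) (h : |(ψ z).arg + l * (ψ y).arg + k * (ψ x).arg| < Real.pi) :
    (ψ (z + l • y + k • x)).arg = (ψ z).arg + l * (ψ y).arg + k * (ψ x).arg := by
  have e : ψ (z + l • y + k • x) =
      Complex.exp (((ψ z).arg + l * (ψ y).arg + k * (ψ x).arg : ℝ) * Complex.I) := by
    rw [AddChar.map_add_eq_mul, AddChar.map_add_eq_mul, AddChar.map_nsmul_eq_pow,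
      AddChar.map_nsmul_eq_pow, exp_arg_addChar ψ x, exp_arg_addChar ψ y, exp_arg_addChar ψ z,
      ← Complex.exp_nat_mul, ← Complex.exp_nat_mul, ← Complex.exp_add, ← Complex.exp_add,
      ← exp_arg_addChar, ← exp_arg_addChar, ← exp_arg_addChar]
    congr 1
    push_cast
    ring
  rw [e, Complex.arg_exp_mul_I, toIocMod_eq_self]
  rw [abs_lt] at h
  constructor
  · linarith
  · linarith

theorem exists_le_norm_sub_one : ∃ κ : ℝ, 0 < κ ∧ ∀ z : ℂ, 1 / 100 ≤ |z.arg| → κ ≤ ‖z - 1‖ := by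
  have h : ContinuousAt Complex.arg 1 := Complex.continuousAt_arg (by simp)
  obtain ⟨κ, hκ, h⟩ := Metric.continuousAt_iff.1 h (1 / 100) (by norm_num)
  refine ⟨κ, hκ, fun z hz => ?_⟩
  by_contra! hlt
  have := h (x := z) (by rwa [dist_eq_norm])
  rw [Complex.arg_one, Real.dist_eq, sub_zero] at this
  linarith

variable {R : Type} [CommRing R]

/-- The action of an upper shear on symmetric `2 × 2` matrices `(s, t; t, u)`. -/
def symShear (r : R) : R × R × R ≃+ R × R × R where
  toFun x := (x.1 + 2 * r * x.2.1 + r ^ 2 * x.2.2, x.2.1 + r * x.2.2, x.2.2)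
  invFun x := (x.1 - 2 * r * x.2.1 + r ^ 2 * x.2.2, x.2.1 - r * x.2.2, x.2.2)
  left_inv x := by ext <;> simp; ring
  right_inv x := by ext <;> simp; ring
  map_add' x y := by ext <;> simp <;> ring

/-- The action of a lower shear on symmetric `2 × 2` matrices `(s, t; t, u)`. -/
def symShear' (r : R) : R × R × R ≃+ R × R × R where
  toFun x := (x.1, x.2.1 + r * x.1, x.2.2 + 2 * r * x.2.1 + r ^ 2 * x.1)
  invFun x := (x.1, x.2.1 - r * x.1, x.2.2 - 2 * r * x.2.1 + r ^ 2 * x.1)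
  left_inv x := by ext <;> simp; ring
  right_inv x := by ext <;> simp; ring
  map_add' x y := by ext <;> simp <;> ring

open Classical in
/-- Dominance count of a character, cf. `one_le_pingPong`. -/
noncomputable def charPingPong (ψ : AddChar (R × R × R) ℂ) : ℝ :=
  ∑ n ∈ Finset.range 5,
    (((if |(ψ.compAddMonoidHom (symShear (2 * n : R)).toAddMonoidHom (1, 0, 0)).arg| <
          |(ψ.compAddMonoidHom (symShear (2 * n : R)).toAddMonoidHom (0, 0, 1)).arg| then 1 else 0)
        - if |(ψ (1, 0, 0)).arg| < |(ψ (0, 0, 1)).arg| then 1 else 0)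
      + ((if |(ψ.compAddMonoidHom (symShear' (2 * n : R)).toAddMonoidHom (0, 0, 1)).arg| <
          |(ψ.compAddMonoidHom (symShear' (2 * n : R)).toAddMonoidHom (1, 0, 0)).arg| then 1 else 0)
        - if |(ψ (0, 0, 1)).arg| < |(ψ (1, 0, 0)).arg| then 1 else 0))

theorem neg_ten_le_charPingPong (ψ : AddChar (R × R × R) ℂ) : -10 ≤ charPingPong ψ := by
  classical
  have : ∑ n ∈ Finset.range 5, (-2 : ℝ) ≤ charPingPong ψ := by
    refine Finset.sum_le_sum fun n _ => ?_
    split_ifs <;> norm_num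
  simpa using this.trans' (by norm_num)

theorem charPingPong_one : charPingPong (1 : AddChar (R × R × R) ℂ) = 0 := by
  simp [charPingPong]

variable [Fintype R]

theorem addChar_eq_one_of_arg (hR : Function.Surjective (Int.cast : ℤ → R))
    {ψ : AddChar (R × R × R) ℂ} (h1 : (ψ (1, 0, 0)).arg = 0) (h2 : (ψ (0, 1, 0)).arg = 0)
    (h3 : (ψ (0, 0, 1)).arg = 0) : ψ = 1 := by
  have e1 : ψ (1, 0, 0) = 1 := by rw [exp_arg_addChar ψ, h1]; simp
  have e2 : ψ (0, 1, 0) = 1 := by rw [exp_arg_addChar ψ, h2]; simp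
  have e3 : ψ (0, 0, 1) = 1 := by rw [exp_arg_addChar ψ, h3]; simp
  ext ⟨s, t, u⟩
  obtain ⟨s, rfl⟩ := hR s
  obtain ⟨t, rfl⟩ := hR t
  obtain ⟨u, rfl⟩ := hR u
  have : (((s : R), (t : R), (u : R)) : R × R × R) =
      s • (1, 0, 0) + t • (0, 1, 0) + u • (0, 0, 1) := by
    ext <;> simp
  rw [this, AddChar.map_add_eq_mul, AddChar.map_add_eq_mul, AddChar.map_zsmul_eq_zpow,
    AddChar.map_zsmul_eq_zpow, AddChar.map_zsmul_eq_zpow, e1, e2, e3]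
  simp

theorem one_le_charPingPong (hR : Function.Surjective (Int.cast : ℤ → R))
    {ψ : AddChar (R × R × R) ℂ} (hψ : ψ ≠ 1) (h1 : |(ψ (1, 0, 0)).arg| < 1 / 100)
    (h2 : |(ψ (0, 1, 0)).arg| < 1 / 100) (h3 : |(ψ (0, 0, 1)).arg| < 1 / 100) :
    1 ≤ charPingPong ψ := by
  classical
  have hne : ¬ ((ψ (1, 0, 0)).arg = 0 ∧ (ψ (0, 1, 0)).arg = 0 ∧ (ψ (0, 0, 1)).arg = 0) :=
    fun h => hψ (addChar_eq_one_of_arg hR h.1 h.2.1 h.2.2)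
  refine (one_le_pingPong hne).trans_eq (Finset.sum_congr rfl fun n hn => ?_)
  have hn4 : (n : ℝ) ≤ 4 := by
    exact_mod_cast Nat.lt_succ_iff.1 (Finset.mem_range.1 hn)
  have hn0 : (0 : ℝ) ≤ n := n.cast_nonneg
  have hpi := Real.pi_gt_three
  have bound : ∀ {a b c : ℝ}, |a| < 1 / 100 → |b| < 1 / 100 → |c| < 1 / 100 →
      |c + ((2 * n : ℕ) : ℝ) * b + ((4 * n ^ 2 : ℕ) : ℝ) * a| < Real.pi := by
    intro a b c ha hb hc
    have hnn : (n : ℝ) ^ 2 ≤ 16 := by nlinarith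
    have t1 : |((2 * n : ℕ) : ℝ) * b| ≤ 8 * (1 / 100) := by
      rw [abs_mul, Nat.abs_cast]
      exact mul_le_mul (by push_cast; linarith) hb.le (abs_nonneg _) (by norm_num)
    have t2 : |((4 * n ^ 2 : ℕ) : ℝ) * a| ≤ 64 * (1 / 100) := by
      rw [abs_mul, Nat.abs_cast]
      exact mul_le_mul (by push_cast; linarith) ha.le (abs_nonneg _) (by norm_num)
    have t3 := abs_add_three c (((2 * n : ℕ) : ℝ) * b) (((4 * n ^ 2 : ℕ) : ℝ) * a)
    linarith
  have a1 := arg_addChar_add ψ (1, 0, 0) (0, 1, 0) (0, 0, 1) (4 * n ^ 2) (2 * n) (bound h1 h2 h3)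
  have a2 := arg_addChar_add ψ (0, 0, 1) (0, 1, 0) (1, 0, 0) (4 * n ^ 2) (2 * n) (bound h3 h2 h1)
  have s1 : symShear (2 * n : R) (0, 0, 1) =
      (0, 0, 1) + (2 * n) • (0, 1, 0) + (4 * n ^ 2) • (1, 0, 0) := by
    ext <;> simp [symShear]; ring
  have s2 : symShear' (2 * n : R) (1, 0, 0) =
      (1, 0, 0) + (2 * n) • (0, 1, 0) + (4 * n ^ 2) • (0, 0, 1) := by
    ext <;> simp [symShear']; ring
  have s3 : symShear (2 * n : R) (1, 0, 0) = (1, 0, 0) := by ext <;> simp [symShear]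
  have s4 : symShear' (2 * n : R) (0, 0, 1) = (0, 0, 1) := by ext <;> simp [symShear']
  simp only [AddChar.compAddMonoidHom_apply, AddEquiv.toAddMonoidHom_eq_coe,
    AddMonoidHom.coe_coe, s1, s2, s3, s4, a1, a2]
  push_cast
  rfl

theorem sum_indicator_comp_le {ι : Type*} [Fintype ι] {w : ι → ℝ} {e : ι → ι}
    (he : Function.Bijective e) {η : ℝ} (hη : ∑ ψ, |w (e ψ) - w ψ| ≤ η) (p : ι → Prop)
    [DecidablePred p] :
    ∑ ψ, w ψ * ((if p (e ψ) then 1 else 0) - if p ψ then 1 else 0) ≤ η := by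
  have h1 : ∑ ψ, w ψ * (if p ψ then 1 else 0) = ∑ ψ, w (e ψ) * (if p (e ψ) then 1 else 0) :=
    (Function.Bijective.sum_comp he fun ψ => w ψ * (if p ψ then 1 else 0)).symm
  simp only [mul_sub, Finset.sum_sub_distrib]
  rw [h1, ← Finset.sum_sub_distrib]
  refine (Finset.sum_le_sum fun ψ _ => ?_).trans hη
  rw [← sub_mul, abs_sub_comm]
  split_ifs
  · rw [mul_one]; exact le_abs_self _
  · rw [mul_zero]; exact abs_nonneg _

theorem compAddMonoidHom_bijective {A : Type*} [AddCommGroup A] [Finite A] (φ : A ≃+ A) :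
    Function.Bijective fun ψ : AddChar A ℂ => ψ.compAddMonoidHom φ.toAddMonoidHom := by
  rw [← Finite.injective_iff_bijective]
  intro ψ χ h
  ext x
  simpa using DFunLike.congr_fun h (φ.symm x)

/-- Quantitative relative property (T) for `(SL₂(R) ⋉ Sym²(R), Sym²(R))`, uniformly over the
finite quotients `R` of `ℤ`. -/
theorem relative_propertyT (δ : ℝ) (hδ : 0 < δ) : ∃ ε : ℝ, 0 < ε ∧
    ∀ (R : Type) [CommRing R] [Fintype R], Function.Surjective (Int.cast : ℤ → R) →
    ∀ (H : Type) [NormedAddCommGroup H] [InnerProductSpace ℂ H]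
      (σ : Multiplicative (R × R × R) →* (H ≃ₗᵢ[ℂ] H)) (T T' : ℕ → (H ≃ₗᵢ[ℂ] H)) (v : H),
      (∀ n x w, T n (σ (.ofAdd x) w) = σ (.ofAdd (symShear (2 * n : R) x)) (T n w)) →
      (∀ n x w, T' n (σ (.ofAdd x) w) = σ (.ofAdd (symShear' (2 * n : R) x)) (T' n w)) →
      (∀ n < 5, ‖T n v - v‖ ≤ ε * ‖v‖) → (∀ n < 5, ‖T' n v - v‖ ≤ ε * ‖v‖) →
      ‖σ (.ofAdd (1, 0, 0)) v - v‖ ≤ ε * ‖v‖ → ‖σ (.ofAdd (0, 1, 0)) v - v‖ ≤ ε * ‖v‖ →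
      ‖σ (.ofAdd (0, 0, 1)) v - v‖ ≤ ε * ‖v‖ →
      ∀ x, ‖σ (.ofAdd x) v - v‖ ≤ δ * ‖v‖ := by
  classical
  obtain ⟨κ, hκ, hκ'⟩ := exists_le_norm_sub_one
  set C : ℝ := 4 * (20 + 33 / κ ^ 2) with hC
  have hC0 : 0 < C := by positivity
  refine ⟨min 1 (δ ^ 2 / C), by positivity, ?_⟩
  set ε := min 1 (δ ^ 2 / C)
  have hε1 : ε ≤ 1 := min_le_left _ _
  have hε0 : 0 < ε := by positivity
  have hεδ : C * ε ≤ δ ^ 2 := by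
    have : ε ≤ δ ^ 2 / C := min_le_right _ _
    rw [le_div_iff₀ hC0] at this
    linarith
  intro R _ _ hR H _ _ σ T T' v hT hT' hTv hTv' h1 h2 h3 x
  set w : AddChar (R × R × R) ℂ → ℝ := fun ψ => ‖isotypic σ ψ v‖ ^ 2 with hw
  have hw0 : ∀ ψ, 0 ≤ w ψ := fun ψ => sq_nonneg _
  have hfar : ∀ y, ‖σ (.ofAdd y) v - v‖ ≤ ε * ‖v‖ →
      ∑ ψ, w ψ * (if |(ψ y).arg| < 1 / 100 then 0 else 1) ≤ ε / κ ^ 2 * ‖v‖ ^ 2 := by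
    intro y hy
    have : ∑ ψ, κ ^ 2 * (w ψ * (if |(ψ y).arg| < 1 / 100 then 0 else 1)) ≤
        ‖σ (.ofAdd y) v - v‖ ^ 2 := by
      rw [norm_apply_sub_sq]
      refine Finset.sum_le_sum fun ψ _ => ?_
      split_ifs with hlt
      · rw [mul_zero, mul_zero]; positivity
      · rw [mul_one]
        exact mul_le_mul_of_nonneg_right (pow_le_pow_left₀ hκ.le (hκ' _ (not_lt.1 hlt)) 2) (hw0 ψ)
    rw [← Finset.mul_sum] at this
    have h4 : ‖σ (.ofAdd y) v - v‖ ^ 2 ≤ (ε * ‖v‖) ^ 2 :=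
      pow_le_pow_left₀ (norm_nonneg _) hy 2
    have h5 : (ε * ‖v‖) ^ 2 ≤ ε * ‖v‖ ^ 2 := by
      rw [mul_pow]
      exact mul_le_mul_of_nonneg_right (by nlinarith) (sq_nonneg _)
    rw [div_mul_eq_mul_div, le_div_iff₀ (by positivity)]
    linarith
  have hping : ∑ ψ, w ψ * charPingPong ψ ≤ 20 * ε * ‖v‖ ^ 2 := by
    have hmove : ∀ (U : H ≃ₗᵢ[ℂ] H) (φ : R × R × R ≃+ R × R × R),
        (∀ x w, U (σ (.ofAdd x) w) = σ (.ofAdd (φ x)) (U w)) → ‖U v - v‖ ≤ ε * ‖v‖ →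
        ∑ ψ, |w (ψ.compAddMonoidHom φ.toAddMonoidHom) - w ψ| ≤ 2 * ε * ‖v‖ ^ 2 := by
      intro U φ hU hUv
      refine (sum_abs_isotypic_sub_le σ U φ hU v).trans ?_
      nlinarith [norm_nonneg v]
    simp only [charPingPong, Finset.mul_sum]
    rw [Finset.sum_comm]
    calc _ ≤ ∑ n ∈ Finset.range 5, (2 * ε * ‖v‖ ^ 2 + 2 * ε * ‖v‖ ^ 2) := by
          refine Finset.sum_le_sum fun n hn => ?_
          have hn := Finset.mem_range.1 hn
          simp only [mul_add, Finset.sum_add_distrib]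
          exact add_le_add
            (sum_indicator_comp_le (compAddMonoidHom_bijective _) (hmove _ _ (hT n) (hTv n hn))
              fun ψ => |(ψ (1, 0, 0)).arg| < |(ψ (0, 0, 1)).arg|)
            (sum_indicator_comp_le (compAddMonoidHom_bijective _) (hmove _ _ (hT' n) (hTv' n hn))
              fun ψ => |(ψ (0, 0, 1)).arg| < |(ψ (1, 0, 0)).arg|)
      _ = _ := by simp; ring
  have hpoint : ∀ ψ : AddChar (R × R × R) ℂ, (if ψ = 1 then 0 else 1 : ℝ) ≤ charPingPong ψ +
      11 * ((if |(ψ (1, 0, 0)).arg| < 1 / 100 then 0 else 1) +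
        (if |(ψ (0, 1, 0)).arg| < 1 / 100 then 0 else 1) +
        (if |(ψ (0, 0, 1)).arg| < 1 / 100 then 0 else 1)) := by
    intro ψ
    have h10 := neg_ten_le_charPingPong ψ
    by_cases hψ : ψ = 1
    · subst hψ
      rw [charPingPong_one]
      simp
    · by_cases hD : |(ψ (1, 0, 0)).arg| < 1 / 100 ∧ |(ψ (0, 1, 0)).arg| < 1 / 100 ∧
          |(ψ (0, 0, 1)).arg| < 1 / 100
      · have := one_le_charPingPong hR hψ hD.1 hD.2.1 hD.2.2
        simpa only [hψ, hD, if_true, if_false, add_zero, mul_zero] using this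
      · rw [if_neg hψ]
        split_ifs <;> first | linarith | (exact absurd ⟨‹_›, ‹_›, ‹_›⟩ hD)
  have hnontriv : ∑ ψ, w ψ * (if ψ = 1 then 0 else 1 : ℝ) ≤ (20 + 33 / κ ^ 2) * ε * ‖v‖ ^ 2 := by
    have := Finset.sum_le_sum fun ψ (_ : ψ ∈ Finset.univ) =>
      mul_le_mul_of_nonneg_left (hpoint ψ) (hw0 ψ)
    refine this.trans ?_
    simp only [mul_add, Finset.sum_add_distrib, mul_left_comm _ (11 : ℝ), ← Finset.mul_sum]
    have e1 := hfar _ h1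
    have e2 := hfar _ h2
    have e3 := hfar _ h3
    have : (20 + 33 / κ ^ 2) * ε * ‖v‖ ^ 2 =
      20 * ε * ‖v‖ ^ 2 + 33 * (ε / κ ^ 2 * ‖v‖ ^ 2) := by ring
    linarith
  have hfinal : ‖σ (.ofAdd x) v - v‖ ^ 2 ≤ (δ * ‖v‖) ^ 2 := by
    rw [norm_apply_sub_sq]
    calc _ ≤ ∑ ψ, 4 * (w ψ * (if ψ = 1 then 0 else 1 : ℝ)) := by
          refine Finset.sum_le_sum fun ψ _ => ?_
          split_ifs with hψ
          · simp [hψ]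
          · have : ‖ψ x - 1‖ ≤ 2 := by
              refine (norm_sub_le _ _).trans ?_
              rw [AddChar.norm_apply]; norm_num
            have : ‖ψ x - 1‖ ^ 2 ≤ 4 := by nlinarith [norm_nonneg (ψ x - 1)]
            nlinarith [hw0 ψ]
      _ ≤ 4 * ((20 + 33 / κ ^ 2) * ε * ‖v‖ ^ 2) := by
          rw [← Finset.mul_sum]; linarith
      _ = C * ε * ‖v‖ ^ 2 := by rw [hC]; ring
      _ ≤ _ := by rw [mul_pow]; exact mul_le_mul_of_nonneg_right hεδ (sq_nonneg _)
  exact (sq_le_sq₀ (norm_nonneg _) (by positivity)).1 hfinal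

end RelativeT

namespace SympSieve

open Matrix Module

theorem exists_single_eq_smul {l R : Type} [DecidableEq l] [CommRing R] (i j : l) :
    ∃ P : Matrix l l R, ∀ x, single i j x = x • P :=
  ⟨single i j 1, fun x => by simp⟩

section Elements

variable {l R S : Type} [Fintype l] [DecidableEq l] [CommRing R] [CommRing S]

/-- The homomorphism of symplectic groups induced by a ring homomorphism. -/
def spMap (l : Type) [Fintype l] [DecidableEq l] (f : R →+* S) :
    symplecticGroup l R →* symplecticGroup l S where
  toFun A := ⟨(A : Matrix (l ⊕ l) (l ⊕ l) R).map f, SymplecticGroup.map_mem A.2 f⟩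
  map_one' := Subtype.ext (Matrix.map_one f f.map_zero f.map_one)
  map_mul' _ _ := Subtype.ext (Matrix.map_mul (f := f))

@[simp]
theorem coe_spMap (f : R →+* S) (A : symplecticGroup l R) :
    (spMap l f A : Matrix (l ⊕ l) (l ⊕ l) S) = (A : Matrix (l ⊕ l) (l ⊕ l) R).map f := rfl

/-- The upper Siegel unipotent with off-diagonal block `X + Xᵀ`. -/
def upper (l R : Type) [Fintype l] [DecidableEq l] [CommRing R] :
    Multiplicative (Matrix l l R) →* symplecticGroup l R where
  toFun X := ⟨fromBlocks 1 (X.toAdd + X.toAddᵀ) 0 1, by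
    rw [SymplecticGroup.fromBlocks_mem_iff]
    simp [add_comm]⟩
  map_one' := by ext1; simp
  map_mul' X Y := by ext1; simp [fromBlocks_multiply]; abel

/-- The lower Siegel unipotent with off-diagonal block `X + Xᵀ`. -/
def lower (l R : Type) [Fintype l] [DecidableEq l] [CommRing R] :
    Multiplicative (Matrix l l R) →* symplecticGroup l R where
  toFun X := ⟨fromBlocks 1 0 (X.toAdd + X.toAddᵀ) 1, by
    rw [SymplecticGroup.fromBlocks_mem_iff]
    simp [add_comm]⟩
  map_one' := by ext1; simp
  map_mul' X Y := by ext1; simp [fromBlocks_multiply]; abel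

theorem coe_upper (X : Matrix l l R) :
    (upper l R (.ofAdd X) : Matrix (l ⊕ l) (l ⊕ l) R) = fromBlocks 1 (X + Xᵀ) 0 1 := rfl

theorem coe_lower (X : Matrix l l R) :
    (lower l R (.ofAdd X) : Matrix (l ⊕ l) (l ⊕ l) R) = fromBlocks 1 0 (X + Xᵀ) 1 := rfl

theorem symJ_mul_upper (X : Matrix l l R) :
    SymplecticGroup.symJ l R * upper l R (.ofAdd X) =
      lower l R (.ofAdd (-X)) * SymplecticGroup.symJ l R := by
  ext1
  simp only [Submonoid.coe_mul, SymplecticGroup.coe_J, coe_upper, coe_lower, J,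
    fromBlocks_multiply]
  congr 1 <;> simp [add_comm]

theorem spMap_upper (f : R →+* S) (X : Matrix l l R) :
    spMap l f (upper l R (.ofAdd X)) = upper l S (.ofAdd (X.map f)) := by
  ext1
  simp only [coe_spMap, coe_upper, fromBlocks_map]
  congr 1
  · exact Matrix.map_one f f.map_zero f.map_one
  · rw [Matrix.map_add f (map_add f), transpose_map]
  · exact Matrix.map_zero f f.map_zero
  · exact Matrix.map_one f f.map_zero f.map_one

theorem spMap_symJ (f : R →+* S) :
    spMap l f (SymplecticGroup.symJ l R) = SymplecticGroup.symJ l S := by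
  ext1
  simp

/-- The Levi element whose upper block is the transvection `1 + r Eᵢⱼ`. -/
def leviTransvection (r : R) {i j : l} (hij : i ≠ j) : symplecticGroup l R :=
  ⟨fromBlocks (1 + single i j r) 0 0 (1 - single j i r), by
    rw [SymplecticGroup.fromBlocks_mem_iff]
    refine ⟨by simp, by simp, ?_⟩
    simp [mul_sub, add_mul, hij]⟩

theorem coe_leviTransvection (r : R) {i j : l} (hij : i ≠ j) :
    (leviTransvection r hij : Matrix (l ⊕ l) (l ⊕ l) R) =
      fromBlocks (1 + single i j r) 0 0 (1 - single j i r) := rfl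

theorem spMap_leviTransvection (f : R →+* S) (r : R) {i j : l} (hij : i ≠ j) :
    spMap l f (leviTransvection r hij) = leviTransvection (f r) hij := by
  ext1
  simp only [coe_spMap, coe_leviTransvection, fromBlocks_map]
  congr 1
  · rw [Matrix.map_add f (map_add f), Matrix.map_one f f.map_zero f.map_one, Matrix.map_single]
  · exact Matrix.map_zero f f.map_zero
  · exact Matrix.map_zero f f.map_zero
  · rw [Matrix.map_sub f (map_sub f), Matrix.map_one f f.map_zero f.map_one, Matrix.map_single]

/-- The copy of `Sym²(R²)` in the upper unipotent group supported on the indices `i` and `j`. -/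
def symPair (R : Type) [CommRing R] (i j : l) :
    Multiplicative (R × R × R) →* symplecticGroup l R where
  toFun x := upper l R (.ofAdd
    (single i i x.toAdd.1 + single i j (2 * x.toAdd.2.1) + single j j x.toAdd.2.2))
  map_one' := by simp
  map_mul' x y := by
    rw [← map_mul, ← ofAdd_add]
    congr 2
    simp only [toAdd_mul, Prod.fst_add, Prod.snd_add, single_add, mul_add]
    abel

theorem symPair_apply (i j : l) (x : R × R × R) :
    symPair R i j (.ofAdd x) = upper l R (.ofAdd
      (single i i x.1 + single i j (2 * x.2.1) + single j j x.2.2)) := rfl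

theorem leviTransvection_mul_symPair (r : R) {i j : l} (hij : i ≠ j) (x : R × R × R) :
    leviTransvection r hij * symPair R i j (.ofAdd x) =
      symPair R i j (.ofAdd (symShear r x)) * leviTransvection r hij := by
  obtain ⟨s, t, u⟩ := x
  obtain ⟨P, hP⟩ := exists_single_eq_smul (R := R) i i
  obtain ⟨Q, hQ⟩ := exists_single_eq_smul (R := R) i j
  obtain ⟨Q', hQ'⟩ := exists_single_eq_smul (R := R) j i
  obtain ⟨W, hW⟩ := exists_single_eq_smul (R := R) j j
  ext1
  simp only [symPair_apply, Submonoid.coe_mul, coe_upper, coe_leviTransvection, symShear,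
    fromBlocks_multiply]
  congr 1
  · simp
  · simp [add_mul, mul_add, mul_sub, hij, hij.symm]
    simp only [hP, hQ, hQ', hW]
    module
  · simp
  · simp

theorem leviTransvection_mul_symPair' (r : R) {i j : l} (hij : i ≠ j) (x : R × R × R) :
    leviTransvection r hij.symm * symPair R i j (.ofAdd x) =
      symPair R i j (.ofAdd (symShear' r x)) * leviTransvection r hij.symm := by
  obtain ⟨s, t, u⟩ := x
  obtain ⟨P, hP⟩ := exists_single_eq_smul (R := R) i i
  obtain ⟨Q, hQ⟩ := exists_single_eq_smul (R := R) i j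
  obtain ⟨Q', hQ'⟩ := exists_single_eq_smul (R := R) j i
  obtain ⟨W, hW⟩ := exists_single_eq_smul (R := R) j j
  ext1
  simp only [symPair_apply, Submonoid.coe_mul, coe_upper, coe_leviTransvection, symShear',
    fromBlocks_multiply]
  congr 1
  · simp
  · simp [add_mul, mul_add, mul_sub, hij, hij.symm]
    simp only [hP, hQ, hQ', hW]
    module
  · simp
  · simp

end Elements

/-- A finite set of symplectic matrices over `ℤ` which detects almost invariant vectors. -/
def testSet (l : Type) [Fintype l] [DecidableEq l] : Set (symplecticGroup l ℤ) :=
  insert (SymplecticGroup.symJ l ℤ) (⋃ i : l, ⋃ j : l, ⋃ h : i ≠ j, ⋃ n : Fin 5,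
    {leviTransvection (2 * (n : ℕ) : ℤ) h, symPair ℤ i j (.ofAdd (1, 0, 0)),
      symPair ℤ i j (.ofAdd (0, 1, 0)), symPair ℤ i j (.ofAdd (0, 0, 1))})

theorem finite_testSet (l : Type) [Fintype l] [DecidableEq l] : (testSet l).Finite :=
  (Set.finite_iUnion fun _ => Set.finite_iUnion fun _ => Set.finite_iUnion fun _ =>
    Set.finite_iUnion fun _ => Set.toFinite _).insert _

theorem almost_invariant_upper (l : Type) [Fintype l] [DecidableEq l] [Nontrivial l]
    (δ : ℝ) (hδ : 0 < δ) : ∃ ε : ℝ, 0 < ε ∧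
    ∀ (R : Type) [CommRing R] [Fintype R], Function.Surjective (Int.cast : ℤ → R) →
    IsUnit (2 : R) →
    ∀ (H : Type) [NormedAddCommGroup H] [InnerProductSpace ℂ H]
      (π : symplecticGroup l R →* (H ≃ₗᵢ[ℂ] H)) (v : H),
      (∀ x ∈ testSet l, ‖π (spMap l (Int.castRingHom R) x) v - v‖ ≤ ε * ‖v‖) →
      (∀ i j t, ‖π (upper l R (.ofAdd (single i j t))) v - v‖ ≤ δ * ‖v‖) ∧
        ‖π (SymplecticGroup.symJ l R) v - v‖ ≤ δ * ‖v‖ := by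
  obtain ⟨ε, hε, H0⟩ := relative_propertyT δ hδ
  refine ⟨min ε δ, lt_min hε hδ, ?_⟩
  intro R _ _ hR h2 H _ _ π v hv
  have hvε : ∀ x ∈ testSet l, ‖π (spMap l (Int.castRingHom R) x) v - v‖ ≤ ε * ‖v‖ :=
    fun x hx => (hv x hx).trans (by gcongr; exact min_le_left _ _)
  have hmem : ∀ {i j : l} (h : i ≠ j) (n : Fin 5) (x),
      x ∈ ({leviTransvection (2 * (n : ℕ) : ℤ) h, symPair ℤ i j (.ofAdd (1, 0, 0)),
      symPair ℤ i j (.ofAdd (0, 1, 0)), symPair ℤ i j (.ofAdd (0, 0, 1))} :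
        Set (symplecticGroup l ℤ)) → x ∈ testSet l := by
    intro i j h n x hx
    refine Or.inr ?_
    simp only [Set.mem_iUnion]
    exact ⟨i, j, h, n, hx⟩
  have hpair : ∀ i j : l, i ≠ j → ∀ x, ‖π (symPair R i j (.ofAdd x)) v - v‖ ≤ δ * ‖v‖ := by
    intro i j hij
    have hT : ∀ {i j : l} (h : i ≠ j) (n : ℕ), n < 5 →
        ‖π (leviTransvection (2 * (n : R)) h) v - v‖ ≤ ε * ‖v‖ := by
      intro i j h n hn
      have := hvε _ (hmem h ⟨n, hn⟩ _ (Or.inl rfl))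
      rw [spMap_leviTransvection] at this
      simpa using this
    have hmap : ∀ a b c : ℤ, spMap l (Int.castRingHom R) (symPair ℤ i j (.ofAdd (a, b, c))) =
        symPair R i j (.ofAdd ((a : R), (b : R), (c : R))) := by
      intro a b c
      simp only [symPair_apply, spMap_upper]
      congr 2
      simp only [Matrix.map_add _ (map_add (Int.castRingHom R)), Matrix.map_single]
      simp
    have e1 := hvε _ (hmem hij 0 _ (Or.inr (Or.inl rfl)))
    have e2 := hvε _ (hmem hij 0 _ (Or.inr (Or.inr (Or.inl rfl))))
    have e3 := hvε _ (hmem hij 0 _ (Or.inr (Or.inr (Or.inr rfl))))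
    rw [hmap] at e1 e2 e3
    push_cast at e1 e2 e3
    refine H0 R hR H (π.comp (symPair R i j)) (fun n => π (leviTransvection (2 * (n : R)) hij))
      (fun n => π (leviTransvection (2 * (n : R)) hij.symm)) v ?_ ?_ (hT hij) (hT hij.symm) e1 e2 e3
    · intro n x w
      simp only [MonoidHom.comp_apply]
      rw [← isometryRep_mul_apply, leviTransvection_mul_symPair, isometryRep_mul_apply]
    · intro n x w
      simp only [MonoidHom.comp_apply]
      rw [← isometryRep_mul_apply, leviTransvection_mul_symPair' _ hij, isometryRep_mul_apply]
  constructor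
  · intro i j t
    by_cases hij : i = j
    · subst hij
      obtain ⟨j, hj⟩ := exists_ne i
      simpa [symPair_apply] using hpair i j hj.symm (t, 0, 0)
    · obtain ⟨s, rfl⟩ := h2.dvd (a := t)
      simpa [symPair_apply] using hpair i j hij (0, s, 0)
  · have := (hv _ (Or.inl rfl)).trans (mul_le_mul_of_nonneg_right (min_le_right ε δ) (norm_nonneg v))
    rwa [spMap_symJ] at this

section BoundedGeneration

variable {l F : Type} [Fintype l] [DecidableEq l] [Field F]

theorem upper_mulVec (X : Matrix l l F) (a c : l → F) :
    (upper l F (.ofAdd X) : Matrix (l ⊕ l) (l ⊕ l) F) *ᵥ Sum.elim a c =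
      Sum.elim (a + (X + Xᵀ) *ᵥ c) c := by
  simp [coe_upper, fromBlocks_mulVec]

theorem lower_mulVec (X : Matrix l l F) (a c : l → F) :
    (lower l F (.ofAdd X) : Matrix (l ⊕ l) (l ⊕ l) F) *ᵥ Sum.elim a c =
      Sum.elim a (c + (X + Xᵀ) *ᵥ a) := by
  simp [coe_lower, fromBlocks_mulVec, add_comm]

/-- A matrix whose symmetrization has `i`-th column `v` and is supported on the `i`-th row and
column. -/
def columnHalf (i : l) (v : l → F) : Matrix l l F :=
  vecMulVec v (Pi.single i 1) - single i i (v i / 2)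

theorem columnHalf_mulVec (h2 : (2 : F) ≠ 0) (i : l) (v w : l → F) :
    (columnHalf i v + (columnHalf i v)ᵀ) *ᵥ w = w i • v + Pi.single i (v ⬝ᵥ w - v i * w i) := by
  have : (columnHalf i v + (columnHalf i v)ᵀ) = vecMulVec v (Pi.single i 1) +
      vecMulVec (Pi.single i 1) v - single i i (v i) := by
    have : NeZero (2 : F) := ⟨h2⟩
    have h : single i i (v i) = single i i (v i / 2) + single i i (v i / 2) := by
      rw [← single_add, add_halves]
    rw [h, columnHalf, transpose_sub, transpose_vecMulVec, transpose_single]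
    abel
  rw [this, sub_mulVec, add_mulVec, vecMulVec_mulVec, vecMulVec_mulVec, single_mulVec]
  ext k
  by_cases hk : k = i
  · subst hk; simp; ring
  · simp [hk, mul_comm]

/-- The symplectic matrix `M` fixes the first `n` basis vectors. -/
def FixesBelow {g : ℕ} (M : Matrix (Fin g ⊕ Fin g) (Fin g ⊕ Fin g) F) (n : ℕ) : Prop :=
  ∀ k : Fin g, (k : ℕ) < n → M *ᵥ Sum.elim (Pi.single k 1) 0 = Sum.elim (Pi.single k 1) 0

variable {g : ℕ}

theorem FixesBelow.mul {M N : Matrix (Fin g ⊕ Fin g) (Fin g ⊕ Fin g) F} {n : ℕ}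
    (hM : FixesBelow M n) (hN : FixesBelow N n) : FixesBelow (M * N) n := by
  intro k hk
  rw [← mulVec_mulVec, hN k hk, hM k hk]

theorem fixesBelow_upper (X : Matrix (Fin g) (Fin g) F) (n : ℕ) :
    FixesBelow (upper (Fin g) F (.ofAdd X) : Matrix (Fin g ⊕ Fin g) (Fin g ⊕ Fin g) F) n := by
  intro k _
  rw [upper_mulVec]
  simp

theorem fixesBelow_lower (h2 : (2 : F) ≠ 0) (i : Fin g) (v : Fin g → F)
    (hv : ∀ k < i, v k = 0) :
    FixesBelow (lower (Fin g) F (.ofAdd (columnHalf i v)) :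
      Matrix (Fin g ⊕ Fin g) (Fin g ⊕ Fin g) F) i := by
  intro k hk
  have hki : k < i := hk
  rw [lower_mulVec, columnHalf_mulVec h2]
  simp [hki.ne', hv k hki]

theorem FixesBelow.lower_column {M : symplecticGroup (Fin g) F} {i : Fin g}
    (hM : FixesBelow (M : Matrix (Fin g ⊕ Fin g) (Fin g ⊕ Fin g) F) i) {a c : Fin g → F}
    (hac : (M : Matrix (Fin g ⊕ Fin g) (Fin g ⊕ Fin g) F) *ᵥ Sum.elim (Pi.single i 1) 0 =
      Sum.elim a c) : (∀ k < i, c k = 0) ∧ ∃ j ≥ i, a j ≠ 0 ∨ c j ≠ 0 := by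
  have hJ := SymplecticGroup.mem_iff'.1 M.2
  have hc : ∀ k < i, c k = 0 := by
    intro k hk
    have h := congrArg (fun A => Sum.elim (Pi.single k 1) 0 ⬝ᵥ
      (A *ᵥ (Sum.elim (Pi.single i 1) 0 : Fin g ⊕ Fin g → F))) hJ
    beta_reduce at h
    rw [← mulVec_mulVec, ← mulVec_mulVec, hac, dotProduct_mulVec, vecMul_transpose, hM k hk] at h
    simpa [J, fromBlocks_mulVec, neg_mulVec] using h
  refine ⟨hc, ?_⟩
  by_contra! H
  have hz : (M : Matrix (Fin g ⊕ Fin g) (Fin g ⊕ Fin g) F) *ᵥ Sum.elim a c = Sum.elim a c := by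
    have hsum : (Sum.elim a c : Fin g ⊕ Fin g → F) =
        ∑ k, a k • (Sum.elim (Pi.single k 1) 0 : Fin g ⊕ Fin g → F) := by
      ext (k | k)
      · simp [Finset.sum_apply, Pi.single_apply]
      · rcases lt_or_ge k i with hk | hk
        · simp [hc k hk]
        · simp [(H k hk).2]
    rw [hsum, mulVec_sum]
    refine Finset.sum_congr rfl fun k _ => ?_
    rw [mulVec_smul]
    rcases lt_or_ge k i with hk | hk
    · rw [hM k hk]
    · simp [(H k hk).1]
  have hinj := mulVec_injective_of_isUnit
    ((isUnit_iff_isUnit_det _).2 (SymplecticGroup.symplectic_det M.2))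
  have h1 := hinj (hz.trans hac.symm)
  have h2 := congrFun h1 (Sum.inl i)
  simp [(H i le_rfl).1] at h2

theorem exists_fixesBelow_succ (h2 : (2 : F) ≠ 0) (M : symplecticGroup (Fin g) F) (i : Fin g)
    (hM : FixesBelow (M : Matrix (Fin g ⊕ Fin g) (Fin g ⊕ Fin g) F) i) :
    ∃ X₁ X₂ X₃ X₄ : Matrix (Fin g) (Fin g) F,
      FixesBelow ((lower (Fin g) F (.ofAdd X₄) * (upper (Fin g) F (.ofAdd X₃) *
        (lower (Fin g) F (.ofAdd X₂) * (upper (Fin g) F (.ofAdd X₁) * M))) :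
        symplecticGroup (Fin g) F) : Matrix (Fin g ⊕ Fin g) (Fin g ⊕ Fin g) F) (i + 1) := by
  obtain ⟨a, c, hac⟩ : ∃ a c, (M : Matrix (Fin g ⊕ Fin g) (Fin g ⊕ Fin g) F) *ᵥ
      Sum.elim (Pi.single i 1) 0 = Sum.elim a c := ⟨_, _, (Sum.elim_comp_inl_inr _).symm⟩
  obtain ⟨hc, j, hj, hjac⟩ := hM.lower_column hac
  obtain ⟨X₁, a', ha', hj'⟩ : ∃ X₁ : Matrix (Fin g) (Fin g) F, ∃ a',
      a + (X₁ + X₁ᵀ) *ᵥ c = a' ∧ a' j ≠ 0 := by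
    by_cases haj : a j = 0
    · refine ⟨columnHalf j (Pi.single j 1), _, rfl, ?_⟩
      rw [columnHalf_mulVec h2]
      simpa [haj] using hjac
    · exact ⟨0, a, by simp, haj⟩
  obtain ⟨v, hv, c', hc', hci'⟩ : ∃ v : Fin g → F, (∀ k < i, v k = 0) ∧ ∃ c',
      c + (columnHalf i v + (columnHalf i v)ᵀ) *ᵥ a' = c' ∧ c' i ≠ 0 := by
    by_cases hci : c i = 0
    · refine ⟨Pi.single j 1, fun k hk => ?_, _, rfl, ?_⟩
      · simp [(hk.trans_le hj).ne]
      · rw [columnHalf_mulVec h2]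
        simpa [hci, mul_comm] using hj'
    · refine ⟨0, by simp, c, ?_, hci⟩
      rw [columnHalf_mulVec h2]; simp
  have hck' : ∀ k < i, c' k = 0 := by
    intro k hk
    rw [← hc', columnHalf_mulVec h2]
    simp [hk.ne, hc k hk, hv k hk]
  obtain ⟨u, hu⟩ : ∃ u : Fin g → F,
      a' + (columnHalf i u + (columnHalf i u)ᵀ) *ᵥ c' = Pi.single i 1 := by
    refine ⟨-(c' i)⁻¹ • a' +
      Pi.single i ((1 - a' i - (-(c' i)⁻¹ • a') ⬝ᵥ c') / c' i), ?_⟩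
    rw [columnHalf_mulVec h2]
    ext k
    by_cases hk : k = i
    · subst hk
      simp
      field_simp
      ring
    · simp [hk]
      field_simp
      ring
  refine ⟨X₁, columnHalf i v, columnHalf i u, columnHalf i (-c'), ?_⟩
  intro k hk
  rcases Nat.lt_succ_iff_lt_or_eq.1 hk with hk | hk
  · exact (fixesBelow_lower h2 i (-c') (fun k hk => by simp [hck' k hk])).mul
      ((fixesBelow_upper _ _).mul ((fixesBelow_lower h2 i v hv).mul
        ((fixesBelow_upper _ _).mul hM))) k hk
  · obtain rfl : k = i := Fin.ext hk
    simp only [Submonoid.coe_mul, ← mulVec_mulVec]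
    rw [hac, upper_mulVec, ha', lower_mulVec, hc', upper_mulVec, hu, lower_mulVec,
      columnHalf_mulVec h2]
    congr 1
    ext r
    by_cases hr : r = k
    · subst hr; simp
    · simp

theorem eq_upper_of_fixesBelow (h2 : (2 : F) ≠ 0) (M : symplecticGroup (Fin g) F)
    (hM : FixesBelow (M : Matrix (Fin g ⊕ Fin g) (Fin g ⊕ Fin g) F) g) :
    ∃ X, M = upper (Fin g) F (.ofAdd X) := by
  obtain ⟨M, hMs⟩ := M
  obtain ⟨A, B, C, D, rfl⟩ : ∃ A B C D, M = fromBlocks A B C D :=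
    ⟨_, _, _, _, (fromBlocks_toBlocks M).symm⟩
  have hcol : ∀ k, A *ᵥ Pi.single k 1 = Pi.single k 1 ∧ C *ᵥ Pi.single k 1 = 0 := by
    intro k
    have := hM k k.2
    rw [fromBlocks_mulVec, Sum.elim_comp_inl, Sum.elim_comp_inr, mulVec_zero, mulVec_zero,
      add_zero, add_zero] at this
    exact ⟨congrArg (fun f => f ∘ Sum.inl) this, congrArg (fun f => f ∘ Sum.inr) this⟩
  obtain rfl : A = 1 := by
    ext r k
    have := congrFun (hcol k).1 r
    simpa [Matrix.one_apply, Pi.single_apply] using this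
  obtain rfl : C = 0 := by
    ext r k
    have := congrFun (hcol k).2 r
    simpa using this
  obtain ⟨-, hB, hD⟩ := SymplecticGroup.fromBlocks_mem_iff.1 hMs
  obtain rfl : D = 1 := by simpa using hD
  have hB : Bᵀ = B := by simpa using hB
  refine ⟨(2 : F)⁻¹ • B, Subtype.ext ?_⟩
  rw [coe_upper, transpose_smul, hB, ← add_smul, ← two_mul, mul_inv_cancel₀ h2, one_smul]

/-- Uniform bounded generation of `Sp(2g, F)`, phrased through subadditive length functions. -/
theorem length_le (h2 : (2 : F) ≠ 0) (L : symplecticGroup (Fin g) F → ℝ) (B : ℝ)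
    (h1 : L 1 = 0) (hmul : ∀ x y, L (x * y) ≤ L x + L y) (hinv : ∀ x, L x⁻¹ = L x)
    (hu : ∀ i j t, L (upper (Fin g) F (.ofAdd (single i j t))) ≤ B)
    (hl : ∀ i j t, L (lower (Fin g) F (.ofAdd (single i j t))) ≤ B)
    (M : symplecticGroup (Fin g) F) :
    L M ≤ (g * (4 * g ^ 2) + g ^ 2) * B := by
  have hhom : ∀ φ : Multiplicative (Matrix (Fin g) (Fin g) F) →* symplecticGroup (Fin g) F,
      (∀ i j t, L (φ (.ofAdd (single i j t))) ≤ B) → ∀ X, L (φ (.ofAdd X)) ≤ g ^ 2 * B := by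
    intro φ hφ X
    have hsub : ∀ (s : Finset (Fin g)) (f : Fin g → Matrix (Fin g) (Fin g) F),
        L (φ (.ofAdd (∑ i ∈ s, f i))) ≤ ∑ i ∈ s, L (φ (.ofAdd (f i))) := by
      intro s f
      exact Finset.le_sum_of_subadditive (fun X => L (φ (.ofAdd X)))
        (by simp [h1]) (fun x y => by simpa using hmul _ _) s f
    rw [matrix_eq_sum_single X]
    calc _ ≤ ∑ i : Fin g, ∑ j : Fin g, B := (hsub _ _).trans
          (Finset.sum_le_sum fun i _ => (hsub _ _).trans (Finset.sum_le_sum fun j _ => hφ _ _ _))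
      _ = _ := by simp; ring
  have hupper := hhom (upper (Fin g) F) hu
  have hlower := hhom (lower (Fin g) F) hl
  have key : ∀ n ≤ g, ∀ M : symplecticGroup (Fin g) F,
      FixesBelow (M : Matrix (Fin g ⊕ Fin g) (Fin g ⊕ Fin g) F) (g - n) →
      L M ≤ (n * (4 * g ^ 2) + g ^ 2) * B := by
    intro n
    induction n with
    | zero =>
      intro _ M hM
      obtain ⟨X, rfl⟩ := eq_upper_of_fixesBelow h2 M hM
      simpa using hupper X
    | succ n ih =>
      intro hn M hM
      obtain ⟨X₁, X₂, X₃, X₄, hX⟩ := exists_fixesBelow_succ h2 M ⟨g - (n + 1), by omega⟩ hM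
      have := ih (by omega) _ (by convert hX using 1; simp; omega)
      set N := lower (Fin g) F (.ofAdd X₄) * (upper (Fin g) F (.ofAdd X₃) *
        (lower (Fin g) F (.ofAdd X₂) * (upper (Fin g) F (.ofAdd X₁) * M))) with hN
      have hMN : M = (upper (Fin g) F (.ofAdd X₁))⁻¹ * ((lower (Fin g) F (.ofAdd X₂))⁻¹ *
          ((upper (Fin g) F (.ofAdd X₃))⁻¹ * ((lower (Fin g) F (.ofAdd X₄))⁻¹ * N))) := by
        rw [hN]; group
      have e1 := hmul (upper (Fin g) F (.ofAdd X₁))⁻¹ ((lower (Fin g) F (.ofAdd X₂))⁻¹ *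
          ((upper (Fin g) F (.ofAdd X₃))⁻¹ * ((lower (Fin g) F (.ofAdd X₄))⁻¹ * N)))
      have e2 := hmul (lower (Fin g) F (.ofAdd X₂))⁻¹
          ((upper (Fin g) F (.ofAdd X₃))⁻¹ * ((lower (Fin g) F (.ofAdd X₄))⁻¹ * N))
      have e3 := hmul (upper (Fin g) F (.ofAdd X₃))⁻¹ ((lower (Fin g) F (.ofAdd X₄))⁻¹ * N)
      have e4 := hmul (lower (Fin g) F (.ofAdd X₄))⁻¹ N
      rw [← hMN] at e1
      simp only [hinv] at e1 e2 e3 e4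
      have := hupper X₁
      have := hupper X₃
      have := hlower X₂
      have := hlower X₄
      push_cast
      linarith
  exact key g le_rfl M (by intro k hk; omega)

end BoundedGeneration

theorem spMap_lower {l R S : Type} [Fintype l] [DecidableEq l] [CommRing R] [CommRing S]
    (f : R →+* S) (X : Matrix l l R) :
    spMap l f (lower l R (.ofAdd X)) = lower l S (.ofAdd (X.map f)) := by
  ext1
  simp only [coe_spMap, coe_lower, fromBlocks_map]
  congr 1
  · exact Matrix.map_one f f.map_zero f.map_one
  · exact Matrix.map_zero f f.map_zero
  · rw [Matrix.map_add f (map_add f), transpose_map]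
  · exact Matrix.map_one f f.map_zero f.map_one

section Product

variable (l A B : Type) [Fintype l] [DecidableEq l] [CommRing A] [CommRing B]

/-- The symplectic group over a product of two rings. -/
noncomputable def spProdEquiv :
    symplecticGroup l (A × B) ≃* symplecticGroup l A × symplecticGroup l B :=
  MulEquiv.ofBijective ((spMap l (RingHom.fst A B)).prod (spMap l (RingHom.snd A B))) <| by
    constructor
    · intro M N h
      rw [MonoidHom.prod_apply, MonoidHom.prod_apply, Prod.mk.injEq] at h
      ext i j
      · exact congrFun (congrFun (congrArg Subtype.val h.1) i) j
      · exact congrFun (congrFun (congrArg Subtype.val h.2) i) j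
    · rintro ⟨M, N⟩
      set P : Matrix (l ⊕ l) (l ⊕ l) (A × B) := of fun i j => (M.1 i j, N.1 i j)
      have h1 : P.map (RingHom.fst A B) = M.1 := by ext; rfl
      have h2 : P.map (RingHom.snd A B) = N.1 := by ext; rfl
      refine ⟨⟨P, ?_⟩, Prod.ext (Subtype.ext h1) (Subtype.ext h2)⟩
      rw [SymplecticGroup.mem_iff]
      have e1 : (P * J l (A × B) * Pᵀ).map (RingHom.fst A B) =
          (J l (A × B)).map (RingHom.fst A B) := by
        rw [Matrix.map_mul, Matrix.map_mul, transpose_map, h1, map_J]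
        exact SymplecticGroup.mem_iff.1 M.2
      have e2 : (P * J l (A × B) * Pᵀ).map (RingHom.snd A B) =
          (J l (A × B)).map (RingHom.snd A B) := by
        rw [Matrix.map_mul, Matrix.map_mul, transpose_map, h2, map_J]
        exact SymplecticGroup.mem_iff.1 N.2
      ext i j
      · exact congrFun (congrFun e1 i) j
      · exact congrFun (congrFun e2 i) j

variable {l A B}

theorem spProdEquiv_apply (M : symplecticGroup l (A × B)) : spProdEquiv l A B M =
    (spMap l (RingHom.fst A B) M, spMap l (RingHom.snd A B) M) := rfl

theorem spProdEquiv_upper (i j : l) (x : A × B) :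
    spProdEquiv l A B (upper l (A × B) (.ofAdd (single i j x))) =
      (upper l A (.ofAdd (single i j x.1)), upper l B (.ofAdd (single i j x.2))) := by
  rw [spProdEquiv_apply, spMap_upper, spMap_upper, Matrix.map_single, Matrix.map_single]
  rfl

theorem spProdEquiv_lower (i j : l) (x : A × B) :
    spProdEquiv l A B (lower l (A × B) (.ofAdd (single i j x))) =
      (lower l A (.ofAdd (single i j x.1)), lower l B (.ofAdd (single i j x.2))) := by
  rw [spProdEquiv_apply, spMap_lower, spMap_lower, Matrix.map_single, Matrix.map_single]
  rfl

end Product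

theorem length_prod_le {g : ℕ} {A B : Type} [Field A] [Field B] (hA : (2 : A) ≠ 0)
    (hB : (2 : B) ≠ 0) (L : symplecticGroup (Fin g) (A × B) → ℝ) (b : ℝ)
    (h1 : L 1 = 0) (hmul : ∀ x y, L (x * y) ≤ L x + L y) (hinv : ∀ x, L x⁻¹ = L x)
    (hu : ∀ i j t, L (upper (Fin g) (A × B) (.ofAdd (single i j t))) ≤ b)
    (hl : ∀ i j t, L (lower (Fin g) (A × B) (.ofAdd (single i j t))) ≤ b)
    (M : symplecticGroup (Fin g) (A × B)) :
    L M ≤ 2 * (g * (4 * g ^ 2) + g ^ 2) * b := by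
  obtain ⟨⟨x, y⟩, rfl⟩ := (spProdEquiv (Fin g) A B).symm.surjective M
  set e := (spProdEquiv (Fin g) A B).symm with he
  have hx := length_le hA (fun x => L (e (x, 1))) b
    (show L (e (1, 1)) = 0 by rw [← Prod.one_eq_mk, map_one, h1])
    (fun x y => by
      have := hmul (e (x, 1)) (e (y, 1))
      rw [← map_mul, Prod.mk_mul_mk, one_mul] at this
      exact this)
    (fun x => by
      have := hinv (e (x, 1))
      rw [← map_inv, Prod.inv_mk, inv_one] at this
      exact this)
    (fun i j t => by
      convert hu i j (t, 0)
      rw [he, MulEquiv.symm_apply_eq, spProdEquiv_upper]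
      simp)
    (fun i j t => by
      convert hl i j (t, 0)
      rw [he, MulEquiv.symm_apply_eq, spProdEquiv_lower]
      simp) x
  have hy := length_le hB (fun x => L (e (1, x))) b
    (show L (e (1, 1)) = 0 by rw [← Prod.one_eq_mk, map_one, h1])
    (fun x y => by
      have := hmul (e (1, x)) (e (1, y))
      rw [← map_mul, Prod.mk_mul_mk, one_mul] at this
      exact this)
    (fun x => by
      have := hinv (e (1, x))
      rw [← map_inv, Prod.inv_mk, inv_one] at this
      exact this)
    (fun i j t => by
      convert hu i j (0, t)
      rw [he, MulEquiv.symm_apply_eq, spProdEquiv_upper]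
      simp)
    (fun i j t => by
      convert hl i j (0, t)
      rw [he, MulEquiv.symm_apply_eq, spProdEquiv_lower]
      simp) y
  have hxy : e (x, y) = e (x, 1) * e (1, y) := by rw [← map_mul]; simp
  have := hmul (e (x, 1)) (e (1, y))
  rw [hxy]
  linarith

section Displacement

variable {G H : Type*} [Group G] [NormedAddCommGroup H] [InnerProductSpace ℂ H]
  (π : G →* (H ≃ₗᵢ[ℂ] H)) (v : H)

theorem displacement_mul_le (x y : G) :
    ‖π (x * y) v - v‖ ≤ ‖π x v - v‖ + ‖π y v - v‖ := by
  rw [isometryRep_mul_apply]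
  calc _ = ‖π x (π y v - v) + (π x v - v)‖ := by rw [map_sub]; abel_nf
    _ ≤ ‖π x (π y v - v)‖ + ‖π x v - v‖ := norm_add_le _ _
    _ = _ := by rw [LinearIsometryEquiv.norm_map, add_comm]

theorem displacement_inv (x : G) : ‖π x⁻¹ v - v‖ = ‖π x v - v‖ := by
  rw [← LinearIsometryEquiv.norm_map (π x), map_sub, ← isometryRep_mul_apply, norm_sub_rev]
  simp

theorem displacement_list_prod_le {c : ℝ} (L : List G) (hL : ∀ x ∈ L, ‖π x v - v‖ ≤ c) :
    ‖π L.prod v - v‖ ≤ L.length * c := by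
  induction L with
  | nil => simp
  | cons a L ih =>
    rw [List.prod_cons, List.length_cons]
    have h1 := displacement_mul_le π v a L.prod
    have h2 := ih fun x hx => hL x (List.mem_cons_of_mem _ hx)
    have h3 := hL a List.mem_cons_self
    push_cast
    linarith

theorem eq_zero_of_displacement_le_half [Fintype G] (hv : ∑ x, π x v = 0)
    (h : ∀ x, ‖π x v - v‖ ≤ 1 / 2 * ‖v‖) : v = 0 := by
  have h1 : ‖∑ x : G, (π x v - v)‖ ≤ ∑ x : G, 1 / 2 * ‖v‖ :=
    (norm_sum_le _ _).trans (Finset.sum_le_sum fun x _ => h x)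
  rw [Finset.sum_sub_distrib, hv, zero_sub, norm_neg] at h1
  simp only [Finset.sum_const, Finset.card_univ, nsmul_eq_mul, ← Nat.cast_smul_eq_nsmul ℂ,
    norm_smul, Complex.norm_natCast] at h1
  have hc : (0 : ℝ) < Fintype.card G := by exact_mod_cast Fintype.card_pos
  have := le_of_mul_le_mul_left h1 hc
  exact norm_le_zero_iff.1 (by linarith)

theorem sum_norm_sub_average_sq {ι : Type*} (s : Finset ι) (hs : s.Nonempty) (f : ι → H) (r : ℝ)
    (hf : ∀ i ∈ s, ‖f i‖ = r) :
    ∑ i ∈ s, ‖f i - (s.card : ℝ)⁻¹ • ∑ j ∈ s, f j‖ ^ 2 =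
      (s.card : ℝ) * r ^ 2 - ‖∑ j ∈ s, f j‖ ^ 2 / (s.card : ℝ) := by
  have hc : (s.card : ℝ) ≠ 0 := by exact_mod_cast hs.card_pos.ne'
  set u := ∑ j ∈ s, f j with hu
  have hre : ∀ i, ‖f i - (s.card : ℝ)⁻¹ • u‖ ^ 2 =
      ‖f i‖ ^ 2 - 2 * (s.card : ℝ)⁻¹ * RCLike.re (inner ℂ (f i) u) +
        ((s.card : ℝ)⁻¹ * ‖u‖) ^ 2 := by
    intro i
    rw [RCLike.real_smul_eq_coe_smul (K := ℂ), @norm_sub_sq ℂ, inner_smul_right, norm_smul]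
    simp [mul_assoc]
  have h1 : ∑ i ∈ s, RCLike.re (inner ℂ (f i) u) = ‖u‖ ^ 2 := by
    rw [← map_sum, ← sum_inner, ← hu, inner_self_eq_norm_sq]
  have h2 : ∑ i ∈ s, ‖f i‖ ^ 2 = s.card * r ^ 2 := by
    rw [Finset.sum_congr rfl fun i hi => congrArg (· ^ 2) (hf i hi), Finset.sum_const,
      nsmul_eq_mul]
  simp only [hre, Finset.sum_add_distrib, Finset.sum_sub_distrib, ← Finset.mul_sum, h1, h2,
    Finset.sum_const, nsmul_eq_mul]
  field_simp
  ring

/-- If the average of a symmetric set satisfying an odd relation barely contracts `v`, then `v`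
is almost invariant. -/
theorem displacement_le_of_average {S : Finset G} (hS : Admissible S) {k : ℕ} (hk : Odd k)
    (w : Fin k → S) (hw : (List.ofFn fun i => ((w i : G))).prod = 1) {θ : ℝ}
    (h : (S.card : ℝ) ^ 2 * (1 - θ) * ‖v‖ ^ 2 ≤ ‖∑ s ∈ S, π s v‖ ^ 2) :
    ∀ s ∈ S, ‖π s v - v‖ ≤ (k + 1) * √(S.card * θ * ‖v‖ ^ 2) := by
  set N := (S.card : ℝ) with hN
  intro s₀ hs₀
  have hne : S.Nonempty := ⟨s₀, hs₀⟩
  have hc : 0 < N := by rw [hN]; exact_mod_cast hne.card_pos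
  set u := N⁻¹ • ∑ s ∈ S, π s v with hu
  set τ := √(N * θ * ‖v‖ ^ 2) with hτ
  have h1 := sum_norm_sub_average_sq S hne (fun s => π s v) ‖v‖ fun s _ => by simp
  have hvu : ∀ s ∈ S, ‖π s v - u‖ ≤ τ := by
    intro s hs
    refine Real.le_sqrt_of_sq_le ?_
    refine (Finset.single_le_sum (f := fun s => ‖π s v - u‖ ^ 2) (fun _ _ => sq_nonneg _) hs).trans
      (h1.trans_le ?_)
    have : N * (1 - θ) * ‖v‖ ^ 2 ≤ ‖∑ s ∈ S, π s v‖ ^ 2 / N := by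
      rw [le_div_iff₀ hc]; linarith
    linarith
  have huv : ∀ s ∈ S, ‖π s u - v‖ ≤ τ := by
    intro s hs
    have := hvu s⁻¹ ((hS.1 s).1 hs)
    rw [← LinearIsometryEquiv.norm_map (π s), map_sub, ← isometryRep_mul_apply, norm_sub_rev]
      at this
    simpa using this
  have hlist : ∀ L : List G, (∀ x ∈ L, x ∈ S) →
      ‖π L.prod u - (if Odd L.length then v else u)‖ ≤ L.length * τ := by
    intro L
    induction L with
    | nil => simp
    | cons a L ih =>
      intro hL
      have ih := ih fun x hx => hL x (List.mem_cons_of_mem _ hx)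
      have ha := hL a List.mem_cons_self
      rw [List.prod_cons, List.length_cons, isometryRep_mul_apply]
      rw [← LinearIsometryEquiv.norm_map (π a), map_sub] at ih
      have e1 : ‖π a (if Odd L.length then v else u) - (if Odd (L.length + 1) then v else u)‖
          ≤ τ := by
        by_cases ho : Odd L.length
        · simpa [ho, Nat.odd_add_one] using hvu a ha
        · simpa [ho, Nat.odd_add_one] using huv a ha
      have := norm_sub_le_norm_sub_add_norm_sub (π a (π L.prod u))
        (π a (if Odd L.length then v else u)) (if Odd (L.length + 1) then v else u)
      push_cast
      linarith
  have huv' := hlist (List.ofFn fun i => ((w i : G))) (by simp)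
  rw [hw, List.length_ofFn, if_pos hk, map_one] at huv'
  have h2 := norm_sub_le_norm_sub_add_norm_sub (π s₀ v) u v
  have h3 := hvu s₀ hs₀
  have h4 : ‖u - v‖ ≤ k * τ := huv'
  linarith

end Displacement

/-- A spectral gap criterion: a vector moved by some element of a fixed finite set is uniformly
contracted by the average over an admissible set. -/
theorem Admissible.exists_contraction {G : Type} [Group G] {S : Finset G} (hS : Admissible S)
    {T : Set G} (hT : T.Finite) {ε : ℝ} (hε : 0 < ε) : ∃ η : ℝ, 0 < η ∧ η < 1 ∧
    ∀ (H : Type) [NormedAddCommGroup H] [InnerProductSpace ℂ H]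
      (π : G →* (H ≃ₗᵢ[ℂ] H)) (v : H), (∃ x ∈ T, ε * ‖v‖ < ‖π x v - v‖) →
      ‖∑ s ∈ S, π s v‖ ≤ η * S.card * ‖v‖ := by
  obtain ⟨k, hk, w, hw⟩ := hS.2.2
  have hword : ∀ x : G, ∃ L : List G, (∀ y ∈ L, y ∈ S) ∧ L.prod = x := by
    intro x
    have hx : x ∈ (Subgroup.closure (S : Set G)).toSubmonoid := by rw [hS.2.1]; trivial
    rw [Subgroup.closure_toSubmonoid] at hx
    obtain ⟨L, hL, rfl⟩ := Submonoid.exists_list_of_mem_closure hx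
    exact ⟨L, fun y hy => (hL y hy).elim id fun h => (hS.1 y).2 h, rfl⟩
  choose word hword hprod using hword
  obtain ⟨K, hK⟩ := (hT.image fun x => (word x).length).bddAbove
  have hNpos : 0 < S.card := by
    obtain ⟨m, rfl⟩ := hk
    exact Finset.card_pos.2 ⟨_, (w 0).2⟩
  have hN : (0 : ℝ) < S.card := by exact_mod_cast hNpos
  set D : ℝ := (K + 1) * (k + 1) with hD
  have hD0 : 0 < D := by positivity
  set θ : ℝ := min (1 / 2) ((ε / D) ^ 2 / S.card) with hθ
  have hθ0 : 0 < θ := by positivity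
  have hθ1 : θ ≤ 1 / 2 := min_le_left _ _
  have hθ2 : S.card * θ ≤ (ε / D) ^ 2 := by
    rw [← le_div_iff₀' hN]
    exact min_le_right _ _
  refine ⟨√(1 - θ), Real.sqrt_pos.2 (by linarith),
    (Real.sqrt_lt' one_pos).2 (by linarith), ?_⟩
  rintro H _ _ π v ⟨x, hx, hxv⟩
  by_contra! hlt
  have h1 : (S.card : ℝ) ^ 2 * (1 - θ) * ‖v‖ ^ 2 ≤ ‖∑ s ∈ S, π s v‖ ^ 2 := by
    have := pow_le_pow_left₀ (by positivity) hlt.le 2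
    rw [mul_pow, mul_pow, Real.sq_sqrt (by linarith)] at this
    linarith
  have h2 := displacement_le_of_average π v hS hk w hw h1
  have h3 := displacement_list_prod_le π v (word x) fun y hy => h2 y (hword x y hy)
  rw [hprod] at h3
  have h4 : √(S.card * θ * ‖v‖ ^ 2) ≤ ε / D * ‖v‖ := by
    refine Real.sqrt_le_iff.2 ⟨by positivity, ?_⟩
    rw [mul_pow]
    gcongr
  have h5 : ((word x).length : ℝ) ≤ K + 1 := by
    have : (word x).length ≤ K := hK ⟨x, hx, rfl⟩
    have : ((word x).length : ℝ) ≤ K := by exact_mod_cast this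
    linarith
  have h6 : ((word x).length : ℝ) * ((k + 1) * √(S.card * θ * ‖v‖ ^ 2)) ≤
      (K + 1) * ((k + 1) * (ε / D * ‖v‖)) := by gcongr
  have h7 : (K + 1 : ℝ) * ((k + 1) * (ε / D * ‖v‖)) = ε * ‖v‖ := by
    rw [hD]; field_simp
  linarith

/-- Kazhdan-type estimate, uniform over products of two finite fields. -/
theorem exists_uniform_kazhdan (g : ℕ) (hg : 2 ≤ g) : ∃ ε : ℝ, 0 < ε ∧
    ∀ (A B : Type) [Field A] [Field B] [Fintype A] [Fintype B],
      Function.Surjective (Int.cast : ℤ → A × B) → (2 : A) ≠ 0 → (2 : B) ≠ 0 →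
    ∀ (H : Type) [NormedAddCommGroup H] [InnerProductSpace ℂ H]
      (π : symplecticGroup (Fin g) (A × B) →* (H ≃ₗᵢ[ℂ] H)) (v : H),
      (∀ x ∈ testSet (Fin g), ‖π (spMap (Fin g) (Int.castRingHom (A × B)) x) v - v‖ ≤ ε * ‖v‖) →
      ∀ M, ‖π M v - v‖ ≤ 1 / 2 * ‖v‖ := by
  have : Nontrivial (Fin g) := Fin.nontrivial_iff_two_le.2 hg
  set C : ℝ := 2 * (g * (4 * g ^ 2) + g ^ 2) with hC
  have hC0 : 0 < C := by
    have : (0 : ℝ) < g := by exact_mod_cast (by omega : 0 < g)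
    positivity
  obtain ⟨ε, hε, hinv⟩ := almost_invariant_upper (Fin g) (1 / (6 * C)) (by positivity)
  refine ⟨ε, hε, ?_⟩
  intro A B _ _ _ _ hsurj hA hB H _ _ π v hv M
  obtain ⟨hu, hJ⟩ := hinv (A × B) hsurj (Prod.isUnit_iff.2 ⟨hA.isUnit, hB.isUnit⟩) H π v hv
  set δ := 1 / (6 * C) * ‖v‖
  have hδ : 0 ≤ δ := by positivity
  have := length_prod_le hA hB (fun M => ‖π M v - v‖) (3 * δ) (by simp)
    (displacement_mul_le π v) (displacement_inv π v)
    (fun i j t => (hu i j t).trans (by linarith)) (fun i j t => by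
      have e := symJ_mul_upper (single i j (-t))
      rw [single_neg i j (-t), neg_neg, ← mul_inv_eq_iff_eq_mul] at e
      rw [← e]
      have e1 := displacement_mul_le π v (SymplecticGroup.symJ (Fin g) (A × B) *
        upper (Fin g) (A × B) (.ofAdd (single i j (-t)))) (SymplecticGroup.symJ (Fin g) (A × B))⁻¹
      have e2 := displacement_mul_le π v (SymplecticGroup.symJ (Fin g) (A × B))
        (upper (Fin g) (A × B) (.ofAdd (single i j (-t))))
      rw [displacement_inv] at e1
      linarith [hu i j (-t)]) M
  refine this.trans (le_of_eq ?_)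
  simp only [δ, hC]
  field_simp
  norm_num

section Regular

variable (G : Type) [Group G] [Fintype G]

/-- The right regular representation of a finite group. -/
noncomputable def regularRep : G →* (EuclideanSpace ℂ G ≃ₗᵢ[ℂ] EuclideanSpace ℂ G) where
  toFun x := LinearIsometryEquiv.piLpCongrLeft 2 ℂ ℂ (Equiv.mulRight x⁻¹)
  map_one' := by
    ext f y
    change f (y * 1⁻¹⁻¹) = f y
    simp
  map_mul' x z := by
    ext f y
    change f (y * (x * z)⁻¹⁻¹) = f (y * x⁻¹⁻¹ * z⁻¹⁻¹)
    simp [mul_assoc]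

variable {G}

theorem regularRep_apply (x y : G) (f : EuclideanSpace ℂ G) : regularRep G x f y = f (y * x) := by
  simp [regularRep]

theorem sum_regularRep_eq_zero (f : EuclideanSpace ℂ G) (hf : ∑ x, f x = 0) :
    ∑ x, regularRep G x f = 0 := by
  ext y
  simp only [WithLp.ofLp_sum, Finset.sum_apply, regularRep_apply, PiLp.zero_apply]
  rw [← hf]
  exact Equiv.sum_comp (Equiv.mulLeft y) fun x => f x

end Regular

/-- Summing over words of length `k` amounts to iterating the summation operator. -/
theorem sum_words_eq_iterate {G H : Type} [Group G] [NormedAddCommGroup H]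
    [InnerProductSpace ℂ H] (π : G →* (H ≃ₗᵢ[ℂ] H)) (S : Finset G) (k : ℕ) (v : H) :
    ∑ w : Fin k → S, π (List.ofFn fun i => ((w i : G))).prod v =
      (fun u => ∑ s ∈ S, π s u)^[k] v := by
  induction k with
  | zero => simp
  | succ k ih =>
    rw [Function.iterate_succ_apply', ← ih, ← (Fin.consEquiv fun _ => S).sum_comp,
      Fintype.sum_prod_type, ← Finset.sum_coe_sort S]
    refine Finset.sum_congr rfl fun s _ => ?_
    rw [map_sum]
    refine Finset.sum_congr rfl fun w _ => ?_
    simp [List.ofFn_succ]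

/-- Equidistribution of random walks in the reductions modulo pairs of primes. -/
theorem exists_walk_equidistribution (g : ℕ) (hg : 2 ≤ g)
    {S : Finset (symplecticGroup (Fin g) ℤ)} (hS : Admissible S) :
    ∃ η : ℝ, 0 < η ∧ η < 1 ∧ ∀ (A B : Type) [Field A] [Field B] [Fintype A] [Fintype B]
      [Fintype (symplecticGroup (Fin g) (A × B))],
      Function.Surjective (Int.cast : ℤ → A × B) → (2 : A) ≠ 0 → (2 : B) ≠ 0 →
    ∀ f : symplecticGroup (Fin g) (A × B) → ℝ, (∀ x, |f x| ≤ 1) → ∑ x, f x = 0 → ∀ k : ℕ,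
      |∑ w : Fin k → S, f (spMap (Fin g) (Int.castRingHom (A × B))
        (List.ofFn fun i => (w i : symplecticGroup (Fin g) ℤ)).prod)| ≤
        (η * S.card) ^ k * √(Fintype.card (symplecticGroup (Fin g) (A × B))) := by
  obtain ⟨ε, hε, hkaz⟩ := exists_uniform_kazhdan g hg
  obtain ⟨η, h0, h1, hη⟩ := Admissible.exists_contraction hS (finite_testSet (Fin g)) hε
  refine ⟨η, h0, h1, ?_⟩
  intro A B _ _ _ _ _ hsurj hA hB f hf hf0 k
  set φ := spMap (Fin g) (Int.castRingHom (A × B))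
  set ρ := (regularRep (symplecticGroup (Fin g) (A × B))).comp φ with hρ
  have hstep : ∀ v : EuclideanSpace ℂ (symplecticGroup (Fin g) (A × B)), ∑ x, v x = 0 →
      ‖∑ s ∈ S, ρ s v‖ ≤ η * S.card * ‖v‖ := by
    intro v hv
    by_cases hx : ∃ x ∈ testSet (Fin g), ε * ‖v‖ < ‖ρ x v - v‖
    · exact hη _ ρ v hx
    · push Not at hx
      have := eq_zero_of_displacement_le_half (regularRep (symplecticGroup (Fin g) (A × B))) v (sum_regularRep_eq_zero v hv)
        (hkaz A B hsurj hA hB _ (regularRep (symplecticGroup (Fin g) (A × B))) v hx)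
      simp [this]
  have hsum : ∀ v : EuclideanSpace ℂ (symplecticGroup (Fin g) (A × B)), ∑ x, v x = 0 → ∑ x, (∑ s ∈ S, ρ s v) x = 0 := by
    intro v hv
    simp only [WithLp.ofLp_sum, Finset.sum_apply]
    rw [Finset.sum_comm]
    refine Finset.sum_eq_zero fun s _ => ?_
    rw [← hv]
    simp only [hρ, MonoidHom.comp_apply, regularRep_apply]
    exact Equiv.sum_comp (Equiv.mulRight (φ s)) fun x => v x
  set v : EuclideanSpace ℂ (symplecticGroup (Fin g) (A × B)) := WithLp.toLp 2 fun x => (f x : ℂ) with hv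
  have hv0 : ∑ x, v x = 0 := by
    simp only [hv]
    exact_mod_cast hf0
  have hiter : ∀ k, ‖(fun u => ∑ s ∈ S, ρ s u)^[k] v‖ ≤ (η * S.card) ^ k * ‖v‖ ∧
      ∑ x, ((fun u => ∑ s ∈ S, ρ s u)^[k] v) x = 0 := by
    intro k
    induction k with
    | zero => simpa using hv0
    | succ k ih =>
      rw [Function.iterate_succ_apply']
      refine ⟨(hstep _ ih.2).trans ?_, hsum _ ih.2⟩
      rw [pow_succ', mul_assoc _ _ ‖v‖]
      exact mul_le_mul_of_nonneg_left ih.1 (by positivity)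
  have hvn : ‖v‖ ≤ √(Fintype.card (symplecticGroup (Fin g) (A × B))) := by
    rw [EuclideanSpace.norm_eq]
    refine Real.sqrt_le_sqrt ?_
    calc ∑ x, ‖v x‖ ^ 2 ≤ ∑ _x : symplecticGroup (Fin g) (A × B), (1 : ℝ) := by
          refine Finset.sum_le_sum fun x _ => ?_
          have : ‖v x‖ = |f x| := by simp [hv]
          rw [this]
          exact pow_le_one₀ (abs_nonneg _) (hf x)
      _ = Fintype.card (symplecticGroup (Fin g) (A × B)) := by simp
  have hcoord : (((∑ w : Fin k → S, f (φ (List.ofFn fun i =>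
      (w i : symplecticGroup (Fin g) ℤ)).prod) : ℝ)) : ℂ) =
      ((fun u => ∑ s ∈ S, ρ s u)^[k] v) 1 := by
    rw [← sum_words_eq_iterate]
    simp only [WithLp.ofLp_sum, Finset.sum_apply, hρ, MonoidHom.comp_apply, regularRep_apply]
    simp [hv]
  rw [← Real.norm_eq_abs, ← Complex.norm_real, hcoord]
  exact (PiLp.norm_apply_le _ _).trans ((hiter k).1.trans (by gcongr))

section Torus

variable {F K E : Type*} [Field F] [Field K] [Field E] [Algebra F K] [Algebra K E] [Algebra F E]
  [IsScalarTower F K E]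

variable (F) in
/-- The trace of the area form of a quadratic extension. -/
noncomputable def traceArea (β : Basis (Fin 2) K E) : LinearMap.BilinForm F E :=
  (Algebra.traceForm F K).comp ((β.coord 0).restrictScalars F) ((β.coord 1).restrictScalars F) -
    (Algebra.traceForm F K).comp ((β.coord 1).restrictScalars F) ((β.coord 0).restrictScalars F)

theorem traceArea_apply (β : Basis (Fin 2) K E) (x y : E) :
    traceArea F β x y = Algebra.trace F K (β.det ![x, y]) := by
  simp [traceArea, Basis.det_apply, det_fin_two, Basis.toMatrix_apply, mul_comm]

theorem traceArea_mul_mul (β : Basis (Fin 2) K E) (z x y : E) :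
    traceArea F β (z * x) (z * y) = Algebra.trace F K (Algebra.norm K z * β.det ![x, y]) := by
  rw [traceArea_apply, Algebra.norm_apply, ← Basis.det_comp]
  congr 2

theorem norm_eq_one_iff_traceArea [FiniteDimensional F K] [Algebra.IsSeparable F K]
    (β : Basis (Fin 2) K E) (z : E) :
    Algebra.norm K z = 1 ↔ ∀ x y, traceArea F β (z * x) (z * y) = traceArea F β x y := by
  constructor
  · intro h x y
    rw [traceArea_mul_mul, h, one_mul, traceArea_apply]
  · intro h
    rw [← sub_eq_zero]
    refine (traceForm_nondegenerate F K).1 _ fun a => ?_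
    have h1 := h (a • β 0) (β 1)
    have h2 : β.det ![a • β 0, β 1] = a := by
      simp [Basis.det_apply, det_fin_two, Basis.toMatrix_apply]
    rw [traceArea_mul_mul, traceArea_apply, h2] at h1
    rw [Algebra.traceForm_apply, sub_mul, map_sub, h1, one_mul, sub_self]

variable {l : Type*} [Fintype l] [DecidableEq l]

/-- A basis of `E` over `F` that is symplectic for the trace of the area form. -/
noncomputable def sympBasis [FiniteDimensional F K] [Algebra.IsSeparable F K]
    (e : Basis l F K) (β : Basis (Fin 2) K E) : Basis (l ⊕ l) F E :=
  (e.prod e.traceDual).map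
    ((β.equivFun ≪≫ₗ LinearEquiv.finTwoArrow K K).restrictScalars F).symm

theorem sympBasis_inl [FiniteDimensional F K] [Algebra.IsSeparable F K]
    (e : Basis l F K) (β : Basis (Fin 2) K E) (i : l) : sympBasis e β (.inl i) = e i • β 0 := by
  simp [sympBasis, Basis.prod_apply]

theorem sympBasis_inr [FiniteDimensional F K] [Algebra.IsSeparable F K]
    (e : Basis l F K) (β : Basis (Fin 2) K E) (i : l) :
    sympBasis e β (.inr i) = e.traceDual i • β 1 := by
  simp [sympBasis, Basis.prod_apply]

theorem toMatrix_traceArea [FiniteDimensional F K] [Algebra.IsSeparable F K]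
    (e : Basis l F K) (β : Basis (Fin 2) K E) :
    LinearMap.BilinForm.toMatrix (sympBasis e β) (traceArea F β) = - J l F := by
  ext (i | i) (j | j) <;>
  simp [sympBasis_inl, sympBasis_inr, traceArea_apply, J, Basis.det_apply, det_fin_two,
    Basis.toMatrix_apply, one_apply, eq_comm]

theorem leftMulMatrix_mem_symplecticGroup [FiniteDimensional F K] [Algebra.IsSeparable F K]
    (e : Basis l F K) (β : Basis (Fin 2) K E) (z : E) :
    Algebra.leftMulMatrix (sympBasis e β) z ∈ symplecticGroup l F ↔ Algebra.norm K z = 1 := by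
  rw [norm_eq_one_iff_traceArea (F := F) β, SymplecticGroup.mem_iff', ← neg_inj, ← neg_mul,
    ← mul_neg, ← toMatrix_traceArea e β, Algebra.leftMulMatrix_apply,
    ← LinearMap.BilinForm.toMatrix_comp, (LinearMap.BilinForm.toMatrix _).injective.eq_iff]
  constructor
  · intro h x y
    exact LinearMap.congr_fun₂ h x y
  · intro h
    ext x y
    exact h x y

end Torus

section TorusCount

open Classical in
/-- The elements of norm one in a finite extension. -/
noncomputable def normOne (K E : Type*) [Field K] [Field E] [Fintype E] [Algebra K E] : Finset E :=
  {z : E | Algebra.norm K z = 1}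

variable {F K E : Type*} [Field F] [Field K] [Field E] [Fintype E] [Algebra F K] [Algebra K E]
  [Algebra F E] [IsScalarTower F K E]

theorem mem_normOne {z : E} : z ∈ normOne K E ↔ Algebra.norm K z = 1 := by
  simp [normOne]

theorem sq_sub_one_eq (q : ℕ) : q ^ 2 - 1 = (q + 1) * (q - 1) := by
  simpa using Nat.sq_sub_sq q 1

theorem natCard_quadratic (h2 : finrank K E = 2) : Nat.card E = Nat.card K ^ 2 := by
  have := Finite.of_injective _ (algebraMap K E).injective
  rw [Module.natCard_eq_pow_finrank (K := K), h2]

theorem le_card_normOne (h2 : finrank K E = 2) : Nat.card K + 1 ≤ (normOne K E).card := by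
  have := Finite.of_injective _ (algebraMap K E).injective
  have hq : 1 < Nat.card K := Finite.one_lt_card
  set ν : Eˣ →* Kˣ := Units.map (Algebra.norm K) with hν
  have h1 := ν.ker.card_mul_index
  rw [Subgroup.index_ker, MonoidHom.range_eq_top.2 (FiniteField.unitsMap_norm_surjective K E),
    Subgroup.card_top, Nat.card_units, Nat.card_units, natCard_quadratic h2, sq_sub_one_eq] at h1
  rw [← Nat.eq_of_mul_eq_mul_right (by omega) h1]
  rw [← Nat.card_eq_finsetCard]
  refine Nat.card_le_card_of_injective
    (fun x : ν.ker => (⟨x.1, mem_normOne.2 (congrArg Units.val (MonoidHom.mem_ker.1 x.2))⟩ :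
      normOne K E)) fun x y h => ?_
  exact Subtype.ext (Units.ext (congrArg Subtype.val h))

theorem pow_eq_one_of_norm_eq_one (h2 : finrank K E = 2) {z : E} (hz : Algebra.norm K z = 1) :
    z ^ (Nat.card K + 1) = 1 := by
  have := Finite.of_injective _ (algebraMap K E).injective
  have hq : 1 < Nat.card K := Finite.one_lt_card
  have h := FiniteField.algebraMap_norm_eq_pow (K := K) (x := z)
  rwa [hz, map_one, natCard_quadratic h2, sq_sub_one_eq, Nat.mul_div_cancel _ (by omega),
    eq_comm] at h

theorem pow_card_pow_natDegree_minpoly (z : E) :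
    z ^ (Nat.card F ^ (minpoly F z).natDegree) = z := by
  have := Finite.of_injective _ (algebraMap F E).injective
  have : Fintype (IntermediateField.adjoin F {z}) := Fintype.ofFinite _
  have h := FiniteField.pow_card (⟨z, IntermediateField.mem_adjoin_simple_self F z⟩ :
    IntermediateField.adjoin F {z})
  rw [← Nat.card_eq_fintype_card, Module.natCard_eq_pow_finrank (K := F),
    IntermediateField.adjoin.finrank (Algebra.IsIntegral.isIntegral z)] at h
  simpa using congrArg Subtype.val h

theorem card_pow_eq_self_le {m : ℕ} (hm : 1 < m) [DecidableEq E] :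
    (Finset.univ.filter fun z : E => z ^ m = z).card ≤ m := by
  open Polynomial in
  have hne : (X ^ m - X : E[X]) ≠ 0 := FiniteField.X_pow_card_sub_X_ne_zero E hm
  refine (Finset.card_le_card (t := (X ^ m - X : E[X]).roots.toFinset) fun z hz => ?_).trans ?_
  · simpa [hne, sub_eq_zero] using hz
  · refine (Multiset.toFinset_card_le _).trans ((Polynomial.card_roots' _).trans ?_)
    rw [FiniteField.X_pow_card_sub_X_natDegree_eq E hm]

theorem card_nongenerators_le [DecidableEq E] {g : ℕ} (hg : finrank F K = g)
    (h2 : finrank K E = 2) :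
    ((normOne K E).filter fun z => (minpoly F z).natDegree ≠ 2 * g).card ≤
      2 + ∑ d ∈ Finset.Ico 1 g, Nat.card F ^ d := by
  have := Finite.of_injective _ (algebraMap F E).injective
  have := Finite.of_injective _ (algebraMap K E).injective
  have hF : 1 < Nat.card F := Finite.one_lt_card
  have hE : finrank F E = 2 * g := by
    rw [← finrank_mul_finrank F K E, hg, h2, mul_comm]
  have hg0 : 0 < g := hg ▸ finrank_pos
  have hsub : (normOne K E).filter (fun z => (minpoly F z).natDegree ≠ 2 * g) ⊆
      {1, -1} ∪ (Finset.Ico 1 g).biUnion fun d =>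
        Finset.univ.filter fun z : E => z ^ (Nat.card F ^ d) = z := by
    intro z hz
    rw [Finset.mem_filter, mem_normOne] at hz
    have h1 := pow_card_pow_natDegree_minpoly (F := F) z
    have h0 : 0 < (minpoly F z).natDegree := minpoly.natDegree_pos (.of_finite F z)
    have hd : (minpoly F z).natDegree ∣ 2 * g := hE ▸ minpoly.degree_dvd (.of_finite F z)
    set d := (minpoly F z).natDegree
    have hdg : d ≤ g := by
      obtain ⟨c, hc⟩ := hd
      have : c ≠ 0 := by rintro rfl; omega
      have : c ≠ 1 := by rintro rfl; omega
      have : 2 ≤ c := by omega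
      nlinarith
    rcases hdg.lt_or_eq with h | h
    · refine Finset.mem_union_right _ (Finset.mem_biUnion.2 ⟨d, by simp; omega, by simpa⟩)
    · refine Finset.mem_union_left _ ?_
      have h3 := pow_eq_one_of_norm_eq_one h2 hz.1
      rw [Module.natCard_eq_pow_finrank (K := F), hg, ← h, pow_succ, h1] at h3
      simpa using mul_self_eq_one_iff.1 h3
  refine (Finset.card_le_card hsub).trans ((Finset.card_union_le _ _).trans ?_)
  refine add_le_add Finset.card_le_two (Finset.card_biUnion_le.trans ?_)
  refine Finset.sum_le_sum fun d hd => card_pow_eq_self_le ?_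
  exact Nat.one_lt_pow (by simp at hd; omega) hF

theorem card_normOne_le_two_mul [DecidableEq E] {g : ℕ} (hg : finrank F K = g)
    (h2 : finrank K E = 2) (hF : 5 ≤ Nat.card F) :
    (normOne K E).card ≤
      2 * ((normOne K E).filter fun z => (minpoly F z).natDegree = 2 * g).card := by
  have := Finite.of_injective _ (algebraMap F E).injective
  have := Finite.of_injective _ (algebraMap K E).injective
  have hg0 : 0 < g := hg ▸ finrank_pos
  have h1 := card_nongenerators_le hg h2
  have h3 := Finset.card_filter_add_card_filter_not (s := normOne K E)
    (fun z => (minpoly F z).natDegree = 2 * g)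
  have h4 := le_card_normOne h2
  rw [Module.natCard_eq_pow_finrank (K := F), hg] at h4
  have h5 : ∀ n, 1 ≤ n → 4 * ∑ d ∈ Finset.Ico 1 n, Nat.card F ^ d + 5 ≤ Nat.card F ^ n := by
    intro n hn
    induction n, hn using Nat.le_induction with
    | base => simpa
    | succ n hn ih =>
      rw [Finset.sum_Ico_succ_top hn, pow_succ]
      have := Nat.mul_le_mul_left (Nat.card F ^ n) hF
      omega
  have h6 := h5 g hg0
  simp only [ne_eq] at h1
  omega

end TorusCount

section RegularTorus

variable {F E : Type*} [Field F] [Field E] [Algebra F E]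
  {ι : Type*} [Fintype ι] [DecidableEq ι]

theorem algebra_adjoin_eq_top [FiniteDimensional F E] {z : E} (hz : (minpoly F z).natDegree = finrank F E) :
    Algebra.adjoin F {z} = ⊤ := by
  rw [← Field.primitive_element_iff_minpoly_natDegree_eq] at hz
  rw [← IntermediateField.adjoin_simple_toSubalgebra_of_isAlgebraic
    (Algebra.IsAlgebraic.isAlgebraic z), hz, IntermediateField.top_toSubalgebra]

theorem exists_leftMulMatrix_of_commute [FiniteDimensional F E] (b : Basis ι F E) {z : E}
    (hz : (minpoly F z).natDegree = finrank F E) {X : Matrix ι ι F}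
    (hX : Commute X (Algebra.leftMulMatrix b z)) : ∃ y, X = Algebra.leftMulMatrix b y := by
  have htop : (Subalgebra.centralizer F {X}).comap (Algebra.leftMulMatrix b) = ⊤ := by
    rw [eq_top_iff, ← algebra_adjoin_eq_top hz, Algebra.adjoin_le_iff, Set.singleton_subset_iff]
    exact (Subalgebra.mem_centralizer_iff F).2 fun Y hY => by rw [hY]; exact hX.eq
  have hcomm : ∀ y, X * Algebra.leftMulMatrix b y = Algebra.leftMulMatrix b y * X := by
    intro y
    have : y ∈ (Subalgebra.centralizer F {X}).comap (Algebra.leftMulMatrix b) := htop ▸ trivial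
    exact (Subalgebra.mem_centralizer_iff F).1 this X rfl
  refine ⟨toLin b b X 1, ?_⟩
  rw [Algebra.leftMulMatrix_apply, ← LinearEquiv.symm_apply_eq, LinearMap.toMatrix_symm]
  refine LinearMap.ext fun y => ?_
  have h := congrArg (fun M => toLin b b M 1) (hcomm y)
  simp only [toLin_mul b b b, LinearMap.comp_apply, Algebra.leftMulMatrix_apply,
    toLin_toMatrix] at h
  simpa [mul_comm] using h

theorem aeval_charpoly_leftMulMatrix (b : Basis ι F E) (z : E) :
    Polynomial.aeval z (Algebra.leftMulMatrix b z).charpoly = 0 := by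
  apply Algebra.leftMulMatrix_injective b
  rw [← Polynomial.aeval_algHom_apply, aeval_self_charpoly, map_zero]

theorem charpoly_leftMulMatrix_eq_minpoly [FiniteDimensional F E] (b : Basis ι F E) {z : E}
    (hz : (minpoly F z).natDegree = finrank F E) :
    (Algebra.leftMulMatrix b z).charpoly = minpoly F z := by
  refine (Polynomial.eq_of_monic_of_dvd_of_natDegree_le
    (minpoly.monic (Algebra.IsIntegral.isIntegral z)) (charpoly_monic _)
    (minpoly.dvd F z (aeval_charpoly_leftMulMatrix b z)) ?_)
  rw [charpoly_natDegree_eq_dim, hz, finrank_eq_card_basis b]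

theorem charpoly_conj {l R : Type*} [Fintype l] [DecidableEq l] [CommRing R]
    (h m : symplecticGroup l R) :
    ((h * m * h⁻¹ : symplecticGroup l R) : Matrix (l ⊕ l) (l ⊕ l) R).charpoly =
      (m : Matrix (l ⊕ l) (l ⊕ l) R).charpoly := by
  rw [Submonoid.coe_mul, charpoly_mul_comm, ← Submonoid.coe_mul]
  simp

end RegularTorus

open Classical in
/-- The symplectic matrices over a finite field with irreducible characteristic polynomial. -/
noncomputable def irredSet (l F : Type*) [Fintype l] [DecidableEq l] [Field F]
    [Fintype (symplecticGroup l F)] : Finset (symplecticGroup l F) :=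
  {A | Irreducible (A : Matrix (l ⊕ l) (l ⊕ l) F).charpoly}

section Fibres

variable {F K E : Type*} [Field F] [Fintype F] [Field K] [Field E] [Fintype E] [Algebra F K]
  [Algebra K E] [Algebra F E] [IsScalarTower F K E] {l : Type*} [Fintype l] [DecidableEq l]

open Classical in
theorem card_mul_card_regular_le [Fintype (symplecticGroup l F)] (e : Basis l F K)
    (h2 : finrank K E = 2) :
    Fintype.card (symplecticGroup l F) *
      ((normOne K E).filter fun z => (minpoly F z).natDegree = 2 * Fintype.card l).card ≤
    2 * Fintype.card l * (normOne K E).card * (irredSet l F).card := by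
  have : Finite K := Finite.of_injective _ (algebraMap K E).injective
  set β : Basis (Fin 2) K E := finBasisOfFinrankEq K E h2
  set b := sympBasis e β
  have hE : finrank F E = 2 * Fintype.card l := by
    rw [finrank_eq_card_basis b, Fintype.card_sum, two_mul]
  set m : E → symplecticGroup l F := fun z =>
    if hz : Algebra.norm K z = 1 then
      ⟨Algebra.leftMulMatrix b z, (leftMulMatrix_mem_symplecticGroup e β z).2 hz⟩ else 1 with hm
  have hmv : ∀ z, Algebra.norm K z = 1 →
      (m z : Matrix (l ⊕ l) (l ⊕ l) F) = Algebra.leftMulMatrix b z := by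
    intro z hz
    simp [hm, hz]
  set T := (normOne K E).filter fun z => (minpoly F z).natDegree = 2 * Fintype.card l with hT
  have hTm : ∀ z ∈ T, Algebra.norm K z = 1 ∧ (minpoly F z).natDegree = finrank F E := by
    intro z hz
    rwa [hT, Finset.mem_filter, mem_normOne, ← hE] at hz
  have hfib : ∀ A : symplecticGroup l F, ∀ z ∈ T,
      (Finset.univ.filter fun h => h * m z * h⁻¹ = A).card ≤ (normOne K E).card := by
    intro A z hz
    rcases (Finset.univ.filter fun h => h * m z * h⁻¹ = A).eq_empty_or_nonempty with h0 | ⟨h₀, h0⟩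
    · simp [h0]
    rw [Finset.mem_filter_univ] at h0
    refine (Finset.card_le_card (t := (normOne K E).image fun y => h₀ * m y) fun h hh => ?_).trans
      Finset.card_image_le
    rw [Finset.mem_filter_univ] at hh
    have hc : Commute (h₀⁻¹ * h) (m z) := by
      have : h * m z * h⁻¹ = h₀ * m z * h₀⁻¹ := by rw [hh, h0]
      rw [mul_inv_eq_iff_eq_mul] at this
      rw [commute_iff_eq, mul_assoc, this]
      group
    have hc' := congrArg Subtype.val hc.eq
    simp only [Submonoid.coe_mul _ _ (m z), Submonoid.coe_mul _ (m z)] at hc'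
    rw [hmv z (hTm z hz).1] at hc'
    obtain ⟨y, hy⟩ := exists_leftMulMatrix_of_commute b (hTm z hz).2 hc'
    have hy1 : Algebra.norm K y = 1 := by
      rw [← leftMulMatrix_mem_symplecticGroup e β y, ← hy]
      exact (h₀⁻¹ * h).2
    refine Finset.mem_image.2 ⟨y, mem_normOne.2 hy1, ?_⟩
    have : m y = h₀⁻¹ * h := Subtype.ext ((hmv y hy1).trans hy.symm)
    rw [this, mul_inv_cancel_left]
  have hmaps : ∀ x ∈ (Finset.univ : Finset (symplecticGroup l F)) ×ˢ T,
      x.1 * m x.2 * x.1⁻¹ ∈ irredSet l F := by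
    intro x hx
    obtain ⟨h1, h3⟩ := hTm x.2 (Finset.mem_product.1 hx).2
    rw [irredSet, Finset.mem_filter_univ, charpoly_conj, hmv _ h1,
      charpoly_leftMulMatrix_eq_minpoly b h3]
    exact minpoly.irreducible (Algebra.IsIntegral.isIntegral _)
  rw [← Finset.card_univ, ← Finset.card_product]
  refine Finset.card_le_mul_card_image_of_maps_to hmaps _ fun A _ => ?_
  have hroots : ∀ x ∈ ((Finset.univ : Finset (symplecticGroup l F)) ×ˢ T).filter
      (fun x => x.1 * m x.2 * x.1⁻¹ = A),
      x.2 ∈ ((A : Matrix (l ⊕ l) (l ⊕ l) F).charpoly.aroots E).toFinset := by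
    intro x hx
    rw [Finset.mem_filter, Finset.mem_product] at hx
    rw [Multiset.mem_toFinset, Polynomial.mem_aroots, ← hx.2, charpoly_conj,
      hmv _ (hTm _ hx.1.2).1]
    exact ⟨(charpoly_monic _).ne_zero, aeval_charpoly_leftMulMatrix b _⟩
  refine (Finset.card_le_mul_card_image_of_maps_to hroots (normOne K E).card
    fun z _ => ?_).trans ?_
  · by_cases hz : z ∈ T
    · refine (Finset.card_le_card_of_injOn (t := Finset.univ.filter fun h => h * m z * h⁻¹ = A)
        Prod.fst ?_ ?_).trans (hfib A z hz)
      · intro x hx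
        simp only [Finset.coe_filter, Set.mem_ofPred_eq, Finset.mem_filter] at hx
        simpa [hx.2] using hx.1.2
      · intro x hx y hy hxy
        simp only [Finset.coe_filter, Set.mem_ofPred_eq] at hx hy
        exact Prod.ext hxy (hx.2.trans hy.2.symm)
    · rw [Finset.filter_eq_empty_iff.2, Finset.card_empty]
      · exact Nat.zero_le _
      · rintro x hx rfl
        rw [Finset.mem_filter, Finset.mem_product] at hx
        exact hz hx.1.2
  · rw [mul_comm]
    gcongr
    refine (Multiset.toFinset_card_le _).trans ((Polynomial.card_roots' _).trans ?_)
    rw [Polynomial.natDegree_map, charpoly_natDegree_eq_dim, Fintype.card_sum, two_mul]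

end Fibres

/-- A proportion at least `1 / (4 g)` of `Sp(2g, 𝔽_p)` has irreducible characteristic polynomial. -/
theorem card_symplecticGroup_le (g : ℕ) (hg : 0 < g) (p : ℕ) [Fact p.Prime] (hp : 5 ≤ p)
    [Fintype (symplecticGroup (Fin g) (ZMod p))] :
    Fintype.card (symplecticGroup (Fin g) (ZMod p)) ≤
      4 * g * (irredSet (Fin g) (ZMod p)).card := by
  classical
  have hK : finrank (ZMod p) (GaloisField p g) = g := GaloisField.finrank p hg.ne'
  set E := FiniteField.Extension (GaloisField p g) p 2
  have : Fintype E := Fintype.ofFinite E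
  have hE : finrank (GaloisField p g) E = 2 := FiniteField.finrank_extension _ p 2
  have h1 := card_mul_card_regular_le (E := E) (finBasisOfFinrankEq (ZMod p) _ hK) hE
  have h2 := card_normOne_le_two_mul (E := E) hK hE (by simpa using hp)
  have h3 := le_card_normOne hE
  rw [Fintype.card_fin] at h1
  have h4 : (normOne (GaloisField p g) E).card * Fintype.card (symplecticGroup (Fin g) (ZMod p)) ≤
      (normOne (GaloisField p g) E).card * (4 * g * (irredSet (Fin g) (ZMod p)).card) := by
    nlinarith
  exact Nat.le_of_mul_le_mul_left h4 (by omega)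

theorem irreducible_charpoly_of_mod {l : Type} [Fintype l] [DecidableEq l] {p : ℕ}
    [Fact p.Prime] (A : symplecticGroup l ℤ)
    (h : Irreducible
      (spMap l (Int.castRingHom (ZMod p)) A : Matrix (l ⊕ l) (l ⊕ l) (ZMod p)).charpoly) :
    Irreducible ((A : Matrix (l ⊕ l) (l ⊕ l) ℤ).charpoly.map (Int.castRingHom ℚ)) := by
  have hm := charpoly_monic (A : Matrix (l ⊕ l) (l ⊕ l) ℤ)
  rw [coe_spMap, charpoly_map] at h
  have h1 := hm.irreducible_of_irreducible_map _ _ h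
  exact (hm.irreducible_iff_irreducible_map_fraction_map (K := ℚ)).1 h1

section Deviation

variable (l F : Type) [Fintype l] [DecidableEq l] [Field F] [Fintype (symplecticGroup l F)]

open Classical in
/-- The centred indicator function of the set of matrices with irreducible characteristic
polynomial. -/
noncomputable def irredDeviation (x : symplecticGroup l F) : ℝ :=
  (if x ∈ irredSet l F then 1 else 0) - (irredSet l F).card / Fintype.card (symplecticGroup l F)

theorem sum_irredDeviation : ∑ x, irredDeviation l F x = 0 := by
  have : (Fintype.card (symplecticGroup l F) : ℝ) ≠ 0 := by simp
  simp only [irredDeviation, Finset.sum_sub_distrib, Finset.sum_boole, Finset.sum_const,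
    Finset.card_univ, nsmul_eq_mul]
  rw [mul_div_cancel₀ _ this]
  simp

theorem abs_irredDeviation_le (x : symplecticGroup l F) : |irredDeviation l F x| ≤ 1 := by
  have h0 : (0 : ℝ) ≤ (irredSet l F).card / Fintype.card (symplecticGroup l F) := by positivity
  have h1 : ((irredSet l F).card : ℝ) / Fintype.card (symplecticGroup l F) ≤ 1 := by
    refine div_le_one_of_le₀ ?_ (by positivity)
    exact_mod_cast Finset.card_le_univ _
  rw [irredDeviation, abs_le]
  split_ifs <;> constructor <;> linarith

end Deviation

theorem irredDeviation_le {g : ℕ} (hg : 0 < g) {p : ℕ} [Fact p.Prime] (hp : 5 ≤ p)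
    [Fintype (symplecticGroup (Fin g) (ZMod p))] {x : symplecticGroup (Fin g) (ZMod p)}
    (hx : x ∉ irredSet (Fin g) (ZMod p)) :
    irredDeviation (Fin g) (ZMod p) x ≤ -(1 / (4 * g)) := by
  have h := card_symplecticGroup_le g hg p hp
  have h' : (Fintype.card (symplecticGroup (Fin g) (ZMod p)) : ℝ) ≤
      4 * g * (irredSet (Fin g) (ZMod p)).card := by exact_mod_cast h
  have hG : (0 : ℝ) < Fintype.card (symplecticGroup (Fin g) (ZMod p)) := by
    exact_mod_cast Fintype.card_pos
  have hg' : (0 : ℝ) < g := by exact_mod_cast hg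
  rw [irredDeviation, if_neg hx, zero_sub, neg_le_neg_iff, div_le_div_iff₀ (by positivity) hG]
  linarith

theorem intCast_prod_surjective {p q : ℕ} (hp : p.Prime) (hq : q.Prime) (hpq : p ≠ q) :
    Function.Surjective (Int.cast : ℤ → ZMod p × ZMod q) := by
  intro x
  have hc : Nat.Coprime p q := (Nat.coprime_primes hp hq).2 hpq
  obtain ⟨n, hn⟩ := ZMod.intCast_surjective ((ZMod.chineseRemainder hc).symm x)
  refine ⟨n, ?_⟩
  rw [RingEquiv.eq_symm_apply, map_intCast] at hn
  exact hn

theorem two_ne_zero_zmod {p : ℕ} (hp : 5 ≤ p) : (2 : ZMod p) ≠ 0 := by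
  have : ((2 : ℕ) : ZMod p) ≠ 0 := by
    rw [Ne, ZMod.natCast_eq_zero_iff]
    intro h
    have := Nat.le_of_dvd two_pos h
    omega
  exact_mod_cast this

/-- A second moment bound. -/
theorem card_mul_sq_le {ι W : Type*} [Fintype W] (P : Finset ι) (u : ι → W → ℝ)
    (hu : ∀ i ∈ P, ∀ w, |u i w| ≤ 1) {B δ : ℝ} (hδ : 0 ≤ δ) (hB0 : 0 ≤ B)
    (hB : ∀ i ∈ P, ∀ j ∈ P, i ≠ j → ∑ w, u i w * u j w ≤ B) (R : Finset W)
    (hR : ∀ w ∈ R, ∀ i ∈ P, u i w ≤ -δ) :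
    R.card * (δ * P.card) ^ 2 ≤ P.card * Fintype.card W + (P.card : ℝ) ^ 2 * B := by
  classical
  calc R.card * (δ * P.card) ^ 2 = ∑ w ∈ R, (δ * P.card) ^ 2 := by simp
    _ ≤ ∑ w ∈ R, (∑ i ∈ P, u i w) ^ 2 := by
        refine Finset.sum_le_sum fun w hw => ?_
        have h : ∑ i ∈ P, u i w ≤ ∑ i ∈ P, -δ := Finset.sum_le_sum (hR w hw)
        rw [Finset.sum_const, nsmul_eq_mul] at h
        rw [← neg_sq (∑ i ∈ P, u i w)]
        gcongr
        linarith
    _ ≤ ∑ w, (∑ i ∈ P, u i w) ^ 2 :=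
        Finset.sum_le_sum_of_subset_of_nonneg (Finset.subset_univ _) fun _ _ _ => sq_nonneg _
    _ = ∑ i ∈ P, ∑ j ∈ P, ∑ w, u i w * u j w := by
        simp_rw [sq, Finset.sum_mul_sum]
        rw [Finset.sum_comm]
        exact Finset.sum_congr rfl fun i _ => Finset.sum_comm
    _ ≤ ∑ i ∈ P, ∑ j ∈ P, ((if i = j then (Fintype.card W : ℝ) else 0) + B) := by
        refine Finset.sum_le_sum fun i hi => Finset.sum_le_sum fun j hj => ?_
        split_ifs with hij
        · subst hij
          have : ∑ w, u i w * u i w ≤ ∑ _w : W, (1 : ℝ) := by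
            refine Finset.sum_le_sum fun w _ => ?_
            rw [← abs_mul_abs_self]
            nlinarith [hu i hi w, abs_nonneg (u i w)]
          rw [Finset.sum_const, nsmul_eq_mul, mul_one, Finset.card_univ] at this
          linarith
        · simpa using hB i hi j hj hij
    _ = P.card * Fintype.card W + (P.card : ℝ) ^ 2 * B := by
        simp only [Finset.sum_add_distrib, Finset.sum_ite_eq, Finset.sum_const, nsmul_eq_mul]
        rw [Finset.sum_ite_of_true (fun _ h => h)]
        simp
        ring

theorem card_symplecticGroup_prod_le (g p q : ℕ) [NeZero p] [NeZero q]
    [Fintype (symplecticGroup (Fin g) (ZMod p × ZMod q))] :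
    Fintype.card (symplecticGroup (Fin g) (ZMod p × ZMod q)) ≤ (p * q) ^ (4 * g ^ 2) := by
  have h := Fintype.card_le_of_injective (fun x : symplecticGroup (Fin g) (ZMod p × ZMod q) =>
    (x : Matrix (Fin g ⊕ Fin g) (Fin g ⊕ Fin g) (ZMod p × ZMod q))) Subtype.val_injective
  refine h.trans (le_of_eq ?_)
  change Fintype.card (Fin g ⊕ Fin g → Fin g ⊕ Fin g → ZMod p × ZMod q) = _
  simp only [Fintype.card_fun, Fintype.card_prod, ZMod.card, Fintype.card_sum, Fintype.card_fin,
    ← pow_mul]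
  congr 1
  ring

/-- The primes in the interval `[5, L]`. -/
def sievePrimes (L : ℕ) : Finset ℕ := (Finset.Icc 5 L).filter Nat.Prime

theorem sqrt_le_card_sievePrimes {L : ℕ} (hL : 1600 ≤ L) :
    √L / 4 ≤ (sievePrimes L).card := by
  have hpi : Nat.primeCounting L ≤ 2 + (sievePrimes L).card := by
    rw [Nat.primeCounting, Nat.primeCounting', Nat.count_eq_card_filter_range]
    have h : (Finset.range (L + 1)).filter Nat.Prime ⊆ {2, 3} ∪ sievePrimes L := by
      intro p hp
      rw [Finset.mem_filter, Finset.mem_range] at hp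
      rw [Finset.mem_union, sievePrimes, Finset.mem_filter, Finset.mem_Icc]
      by_cases h5 : 5 ≤ p
      · exact Or.inr ⟨⟨h5, by omega⟩, hp.2⟩
      · have := hp.2
        interval_cases p <;> first | simp; done | (norm_num at this)
    exact (Finset.card_le_card h).trans ((Finset.card_union_le _ _).trans (by simp))
  have hpi' : (Nat.primeCounting L : ℝ) ≤ 2 + (sievePrimes L).card := by exact_mod_cast hpi
  have hL' : (1600 : ℝ) ≤ L := by exact_mod_cast hL
  set t := √(L : ℝ) with ht
  have ht2 : t ^ 2 = L := Real.sq_sqrt (by positivity)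
  have ht40 : 40 ≤ t := Real.le_sqrt_of_sq_le (by norm_num; exact hL)
  have hlog : Real.log L ≤ 2 * t - 2 := by
    rw [← ht2, Real.log_pow]
    have := Real.log_le_sub_one_of_pos (by linarith : 0 < t)
    push_cast
    linarith
  have hlog1 : Real.log (L + 1) ≤ 2 * t := by
    have h1 : Real.log (L + 1) ≤ Real.log (2 * L) := Real.log_le_log (by linarith) (by linarith)
    rw [Real.log_mul two_ne_zero (by linarith)] at h1
    linarith [Real.log_two_lt_d9]
  have hlog0 : 0 < Real.log L := Real.log_pos (by linarith)
  have h := Chebyshev.pi_ge L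
  have h2 : t / 4 + 2 ≤ (L * Real.log 2 - Real.log (L + 1)) / Real.log L := by
    rw [le_div_iff₀ hlog0]
    have h3 : (t / 4 + 2) * Real.log L ≤ (t / 4 + 2) * (2 * t - 2) := by gcongr
    have h4 : t ^ 2 * 0.69 ≤ L * Real.log 2 := by
      rw [ht2]
      gcongr
      linarith [Real.log_two_gt_d9]
    nlinarith
  linarith

theorem walkProb_le_one {G : Type*} [Group G] (S : Finset G) (k : ℕ) (Z : Set G) :
    walkProb S k Z ≤ 1 := by
  refine div_le_one_of_le₀ ?_ (by positivity)
  have h : Nat.card {w : Fin k → S // (List.ofFn fun i => ((w i : G))).prod ∈ Z} ≤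
      Nat.card (Fin k → S) := Nat.card_le_card_of_injective _ Subtype.val_injective
  rw [Nat.card_fun] at h
  simp only [Nat.card_eq_fintype_card, Fintype.card_fin, Fintype.card_coe] at h
  exact_mod_cast h

/-- Decorrelation of the reductions modulo two distinct primes along a random walk. -/
theorem exists_covariance_bound (g : ℕ) (hg : 2 ≤ g)
    {S : Finset (symplecticGroup (Fin g) ℤ)} (hS : Admissible S) :
    ∃ η : ℝ, 0 < η ∧ η < 1 ∧ ∀ (L k p q : ℕ) [Fact p.Prime] [Fact q.Prime]
      [Fintype (symplecticGroup (Fin g) (ZMod p))] [Fintype (symplecticGroup (Fin g) (ZMod q))],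
      p ≠ q → 5 ≤ p → 5 ≤ q → p ≤ L → q ≤ L →
      ∑ w : Fin k → S, irredDeviation (Fin g) (ZMod p) (spMap (Fin g) (Int.castRingHom (ZMod p))
          (List.ofFn fun i => (w i : symplecticGroup (Fin g) ℤ)).prod) *
        irredDeviation (Fin g) (ZMod q) (spMap (Fin g) (Int.castRingHom (ZMod q))
          (List.ofFn fun i => (w i : symplecticGroup (Fin g) ℤ)).prod) ≤
      (η * S.card) ^ k * L ^ (4 * g ^ 2) := by
  obtain ⟨η, h0, h1, h⟩ := exists_walk_equidistribution g hg hS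
  refine ⟨η, h0, h1, ?_⟩
  intro L k p q hp hq _ _ hpq hp5 hq5 hpL hqL
  have : Fintype (symplecticGroup (Fin g) (ZMod p × ZMod q)) := Fintype.ofFinite _
  set f : symplecticGroup (Fin g) (ZMod p × ZMod q) → ℝ := fun x =>
    irredDeviation (Fin g) (ZMod p) (spMap (Fin g) (RingHom.fst _ _) x) *
      irredDeviation (Fin g) (ZMod q) (spMap (Fin g) (RingHom.snd _ _) x) with hf
  have hsum : ∑ x, f x = 0 := by
    have e : ∑ x, f x = ∑ y : symplecticGroup (Fin g) (ZMod p) × symplecticGroup (Fin g) (ZMod q),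
        irredDeviation (Fin g) (ZMod p) y.1 * irredDeviation (Fin g) (ZMod q) y.2 :=
      (spProdEquiv (Fin g) (ZMod p) (ZMod q)).toEquiv.sum_comp fun y =>
        irredDeviation (Fin g) (ZMod p) y.1 * irredDeviation (Fin g) (ZMod q) y.2
    rw [e, Fintype.sum_prod_type, ← Finset.sum_mul_sum, sum_irredDeviation, zero_mul]
  have hle : ∀ x, |f x| ≤ 1 := by
    intro x
    rw [hf, abs_mul]
    exact mul_le_one₀ (abs_irredDeviation_le _ _ _) (abs_nonneg _) (abs_irredDeviation_le _ _ _)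
  have hb := h (ZMod p) (ZMod q) (intCast_prod_surjective hp.out hq.out hpq)
    (two_ne_zero_zmod hp5) (two_ne_zero_zmod hq5) f hle hsum k
  have hfst : ∀ A, spMap (Fin g) (RingHom.fst (ZMod p) (ZMod q))
      (spMap (Fin g) (Int.castRingHom (ZMod p × ZMod q)) A) =
      spMap (Fin g) (Int.castRingHom (ZMod p)) A := by
    intro A
    ext i j
    simp
  have hsnd : ∀ A, spMap (Fin g) (RingHom.snd (ZMod p) (ZMod q))
      (spMap (Fin g) (Int.castRingHom (ZMod p × ZMod q)) A) =
      spMap (Fin g) (Int.castRingHom (ZMod q)) A := by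
    intro A
    ext i j
    simp
  simp only [hf, hfst, hsnd] at hb
  refine (le_abs_self _).trans (hb.trans ?_)
  gcongr
  rw [Real.sqrt_le_left (by positivity), ← pow_mul, mul_comm _ 2, pow_mul]
  have hcard : (Fintype.card (symplecticGroup (Fin g) (ZMod p × ZMod q)) : ℝ) ≤
      ((p : ℝ) * q) ^ (4 * g ^ 2) := by exact_mod_cast card_symplecticGroup_prod_le g p q
  refine hcard.trans ?_
  rw [sq (L : ℝ)]
  gcongr

/-- The sieve inequality. -/
theorem exists_walkProb_le (g : ℕ) (hg : 2 ≤ g)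
    {S : Finset (symplecticGroup (Fin g) ℤ)} (hS : Admissible S) :
    ∃ η : ℝ, 0 < η ∧ η < 1 ∧ ∀ L k : ℕ, 0 < (sievePrimes L).card →
      walkProb S k {A : symplecticGroup (Fin g) ℤ |
        ¬ Irreducible (((A : Matrix (Fin g ⊕ Fin g) (Fin g ⊕ Fin g) ℤ).charpoly).map
          (Int.castRingHom ℚ))} ≤
      16 * g ^ 2 * (1 / (sievePrimes L).card + η ^ k * L ^ (4 * g ^ 2)) := by
  classical
  obtain ⟨η, h0, h1, h⟩ := exists_covariance_bound g hg hS
  refine ⟨η, h0, h1, fun L k hP => ?_⟩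
  have hmem : ∀ p : sievePrimes L, p.1.Prime ∧ 5 ≤ p.1 ∧ p.1 ≤ L := by
    rintro ⟨p, hp⟩
    rw [sievePrimes, Finset.mem_filter, Finset.mem_Icc] at hp
    exact ⟨hp.2, hp.1⟩
  have : ∀ p : sievePrimes L, Fact p.1.Prime := fun p => ⟨(hmem p).1⟩
  have : ∀ p : sievePrimes L, Fintype (symplecticGroup (Fin g) (ZMod p.1)) :=
    fun p => Fintype.ofFinite _
  have hS0 : 0 < S.card := by
    obtain ⟨m, ⟨n, rfl⟩, w, -⟩ := hS.2.2
    exact Finset.card_pos.2 ⟨_, (w 0).2⟩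
  have hS0' : (0 : ℝ) < S.card := by exact_mod_cast hS0
  have hg0 : (0 : ℝ) < g := by exact_mod_cast (by omega : 0 < g)
  have hP' : (0 : ℝ) < (sievePrimes L).card := by exact_mod_cast hP
  set Z : Set (symplecticGroup (Fin g) ℤ) := {A |
        ¬ Irreducible (((A : Matrix (Fin g ⊕ Fin g) (Fin g ⊕ Fin g) ℤ).charpoly).map
          (Int.castRingHom ℚ))} with hZ
  set R : Finset (Fin k → S) := Finset.univ.filter fun w =>
    (List.ofFn fun i => (w i : symplecticGroup (Fin g) ℤ)).prod ∈ Z with hR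
  have key := card_mul_sq_le (Finset.univ : Finset (sievePrimes L))
    (fun p (w : Fin k → S) => irredDeviation (Fin g) (ZMod p.1)
      (spMap (Fin g) (Int.castRingHom (ZMod p.1))
        (List.ofFn fun i => (w i : symplecticGroup (Fin g) ℤ)).prod))
    (fun p _ w => abs_irredDeviation_le _ _ _) (B := (η * S.card) ^ k * L ^ (4 * g ^ 2))
    (δ := 1 / (4 * g)) (by positivity) (by positivity)
    (fun p _ q _ hpq => h L k p.1 q.1 (fun e => hpq (Subtype.ext e)) (hmem p).2.1 (hmem q).2.1
      (hmem p).2.2 (hmem q).2.2) R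
    (fun w hw p _ => by
      refine irredDeviation_le (by omega) (hmem p).2.1 fun hirr => ?_
      rw [hR, Finset.mem_filter_univ] at hw
      rw [irredSet, Finset.mem_filter_univ] at hirr
      exact hw (irreducible_charpoly_of_mod _ hirr))
  rw [Finset.card_univ, Fintype.card_coe, Fintype.card_fun, Fintype.card_fin, Fintype.card_coe]
    at key
  have hcard : (Nat.card {w : Fin k → S //
      (List.ofFn fun i => (w i : symplecticGroup (Fin g) ℤ)).prod ∈ Z}) = R.card := by
    rw [Nat.card_eq_fintype_card, Fintype.card_subtype]
  rw [walkProb, hcard, div_le_iff₀ (by positivity)]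
  push_cast at key
  rw [mul_pow η] at key
  have e1 : (R.card : ℝ) * (1 / (4 * g) * (sievePrimes L).card) ^ 2 =
      R.card * ((sievePrimes L).card ^ 2 / (16 * g ^ 2)) := by
    field_simp
    ring
  rw [e1, ← le_div_iff₀ (by positivity)] at key
  refine key.trans (le_of_eq ?_)
  field_simp

theorem exists_exp_bound {η : ℝ} (h0 : 0 < η) (h1 : η < 1) (D : ℕ) (hD : 0 < D) (C : ℝ)
    (hC : 0 < C) {pr : ℕ → ℝ} (hpr : ∀ k, pr k ≤ 1)
    (h : ∀ L k : ℕ, 0 < (sievePrimes L).card →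
      pr k ≤ C * (1 / (sievePrimes L).card + η ^ k * L ^ D)) :
    ∃ c α : ℝ, 0 < c ∧ 0 < α ∧ ∀ k : ℕ, pr k ≤ c * Real.exp (-α * k) := by
  set a := -Real.log η with ha
  have ha0 : 0 < a := neg_pos.2 (Real.log_neg h0 h1)
  have hη : ∀ k : ℕ, η ^ k = Real.exp (-a * k) := by
    intro k
    rw [ha, neg_neg, mul_comm, Real.exp_nat_mul, Real.exp_log h0]
  have hD' : (0 : ℝ) < D := by exact_mod_cast hD
  have hD1 : (1 : ℝ) ≤ D := by exact_mod_cast hD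
  set b := a / (2 * D) with hb
  have hb0 : 0 < b := by positivity
  have hba : b * D = a / 2 := by
    rw [hb]
    field_simp
  refine ⟨C * 9 + 1601, b / 2, by positivity, by positivity, fun k => ?_⟩
  by_cases hk : Real.exp (b * k) < 1601
  · refine (hpr k).trans ?_
    have h2 : Real.exp (b * k) * Real.exp (-(b / 2) * k) ≤ 1601 * Real.exp (-(b / 2) * k) := by
      gcongr
    rw [← Real.exp_add] at h2
    have h3 : 1 ≤ Real.exp (b * k + -(b / 2) * k) := Real.one_le_exp (by
      have : 0 ≤ b * k := by positivity
      linarith)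
    have h4 : 0 < C * 9 * Real.exp (-(b / 2) * k) := by positivity
    linarith
  · push Not at hk
    set L := ⌊Real.exp (b * k)⌋₊ with hL
    have hL1 : (L : ℝ) ≤ Real.exp (b * k) := Nat.floor_le (Real.exp_nonneg _)
    have hL2 : Real.exp (b * k) < L + 1 := Nat.lt_floor_add_one _
    have hL3 : 1600 ≤ L := Nat.le_floor (by push_cast; linarith)
    have hL4 : Real.exp (b * k / 2) / 2 ≤ √L := by
      refine Real.le_sqrt_of_sq_le ?_
      rw [div_pow, ← Real.exp_nat_mul]
      have : ((2 : ℕ) : ℝ) * (b * k / 2) = b * k := by push_cast; ring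
      rw [this]
      linarith
    have hc := sqrt_le_card_sievePrimes hL3
    have hexp := Real.exp_pos (b * k / 2)
    have hc' : Real.exp (b * k / 2) / 8 ≤ (sievePrimes L).card := by linarith
    have hc0 : (0 : ℝ) < (sievePrimes L).card := lt_of_lt_of_le (by positivity) hc'
    refine (h L k (by exact_mod_cast hc0)).trans ?_
    have hneg : Real.exp (-(b / 2) * k) = (Real.exp (b * k / 2))⁻¹ := by
      rw [← Real.exp_neg]
      congr 1
      ring
    have t1 : 1 / ((sievePrimes L).card : ℝ) ≤ 8 * Real.exp (-(b / 2) * k) := by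
      rw [hneg, div_le_iff₀ hc0]
      have := mul_le_mul_of_nonneg_left hc' (by positivity : 0 ≤ 8 * (Real.exp (b * k / 2))⁻¹)
      refine le_trans (le_of_eq ?_) this
      field_simp
    have t2 : η ^ k * (L : ℝ) ^ D ≤ Real.exp (-(b / 2) * k) := by
      calc η ^ k * (L : ℝ) ^ D ≤ η ^ k * Real.exp (b * k) ^ D := by gcongr
        _ = Real.exp (-(a / 2) * k) := by
            rw [hη, ← Real.exp_nat_mul, ← Real.exp_add]
            congr 1
            linear_combination (k : ℝ) * hba
        _ ≤ Real.exp (-(b / 2) * k) := by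
            gcongr
            nlinarith
    have t3 := Real.exp_pos (-(b / 2) * k)
    nlinarith

end SympSieve

theorem reducible_charpoly_expSmall_symplectic (g : ℕ) (hg : 2 ≤ g) :
    ExpSmall {A : Matrix.symplecticGroup (Fin g) ℤ |
      ¬ Irreducible (((A : Matrix (Fin g ⊕ Fin g) (Fin g ⊕ Fin g) ℤ).charpoly).map
        (Int.castRingHom ℚ))} := by
  intro S hS
  obtain ⟨η, h0, h1, h⟩ := SympSieve.exists_walkProb_le g hg hS
  exact SympSieve.exists_exp_bound h0 h1 (4 * g ^ 2) (by positivity) (16 * g ^ 2) (by positivity)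
    (fun k => SympSieve.walkProb_le_one S k _) h
end
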